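/- Let n ≥ 2, q ∈ (1,2), p = q/(q−1), α ∈ (0,1), Ω ⊂ ℝⁿ bounded open, and let u ∈ W^{1,q}_loc(Ω) be a local weak solution of −div((|∇u|−1)_+^{q−1} ∇u/|∇u|) = f; set σ₀ = H_{q−1}(∇u). Then: (i) if f ∈ W^{1,p}_loc(Ω), then σ₀ ∈ L^r_loc(Ω) for all r ∈ [1, np(3−q)/(n(3−q)−2)); (ii) if f ∈ B^α_{p,∞,loc}(Ω), then σ₀ ∈ L^s_loc(Ω) for all s < np/(n−α−1) when 0 < α < (q−1)/(3−q), and for all s < np(3−q)/(n(3−q)−2) when (q−1)/(3−q) ≤ α < 1. -/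

import Mathlib

open MeasureTheory Metric
open scoped RealInnerProductSpace ENNReal

/-- `H_a(ξ) = (|ξ|−1)_+^a ξ/|ξ|` (with value `0` at `ξ = 0`). -/
noncomputable def Hmap (n : ℕ) (a : ℝ) (ξ : EuclideanSpace ℝ (Fin n)) :
    EuclideanSpace ℝ (Fin n) :=
  ((max (‖ξ‖ - 1) 0) ^ a / ‖ξ‖) • ξ

/-- The `s`-th standard unit vector `e_s` of `ℝⁿ`. -/
noncomputable def unitVec (n : ℕ) (s : Fin n) : EuclideanSpace ℝ (Fin n) :=
  EuclideanSpace.single s 1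

/-- `u ∈ W^{1,q}_loc(Ω)` with weak gradient `Du`: local `L^q` integrability of `u` and `Du`,
together with the integration-by-parts identity against test functions supported in `Ω`. -/
def MemW1Loc (n : ℕ) (q : ℝ) (Ω : Set (EuclideanSpace ℝ (Fin n)))
    (u : EuclideanSpace ℝ (Fin n) → ℝ)
    (Du : EuclideanSpace ℝ (Fin n) → EuclideanSpace ℝ (Fin n)) : Prop :=
  (∀ K : Set (EuclideanSpace ℝ (Fin n)), IsCompact K → K ⊆ Ω →
      MemLp u (ENNReal.ofReal q) (volume.restrict K) ∧
      MemLp Du (ENNReal.ofReal q) (volume.restrict K)) ∧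
  (∀ φ : EuclideanSpace ℝ (Fin n) → ℝ, ContDiff ℝ 1 φ → HasCompactSupport φ →
      tsupport φ ⊆ Ω →
      ∫ x in Ω, u x • gradient φ x = -∫ x in Ω, φ x • Du x)

/-- `u` (with gradient `Du`) is a local weak solution of
`−div((|∇u|−1)_+^{q−1} ∇u/|∇u|) = f` in `Ω`:
`∫_Ω ⟨H_{q−1}(∇u), ∇φ⟩ = ∫_Ω f φ` for all test functions `φ` supported in `Ω`. -/
def IsLocalWeakSolution (n : ℕ) (q : ℝ) (Ω : Set (EuclideanSpace ℝ (Fin n)))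
    (Du : EuclideanSpace ℝ (Fin n) → EuclideanSpace ℝ (Fin n))
    (f : EuclideanSpace ℝ (Fin n) → ℝ) : Prop :=
  ∀ φ : EuclideanSpace ℝ (Fin n) → ℝ, ContDiff ℝ 1 φ → HasCompactSupport φ →
    tsupport φ ⊆ Ω →
    ∫ x in Ω, ⟪Hmap n (q - 1) (Du x), gradient φ x⟫ = ∫ x in Ω, f x * φ x

/-- The set of Besov difference quotients of `f` on the set `B`:
`(∫_B |f(x+h e_s) − f(x)|^p / |h|^{αp} dx)^{1/p}` over directions `s` and `h ≠ 0`. -/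
def besovSet (n : ℕ) (p α : ℝ) (B : Set (EuclideanSpace ℝ (Fin n)))
    (f : EuclideanSpace ℝ (Fin n) → ℝ) : Set ℝ :=
  {t : ℝ | ∃ (s : Fin n) (h : ℝ), h ≠ 0 ∧
    t = (∫ x in B, |f (x + h • unitVec n s) - f x| ^ p / |h| ^ (α * p)) ^ (1 / p)}

/-- The Besov norm `‖f‖_{B^α_{p,∞}(B)} = ‖f‖_{L^p(B)} + sup_{h≠0} (...)^{1/p}`. -/
noncomputable def besovNormBall (n : ℕ) (p α : ℝ) (B : Set (EuclideanSpace ℝ (Fin n)))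
    (f : EuclideanSpace ℝ (Fin n) → ℝ) : ℝ :=
  (∫ x in B, |f x| ^ p) ^ (1 / p) + sSup (besovSet n p α B f)

/-- `f ∈ B^α_{p,∞,loc}(Ω)`: on every ball compactly contained in `Ω`, `f ∈ L^p` and the
Besov difference quotients are bounded. -/
def MemBesovLoc (n : ℕ) (p α : ℝ) (Ω : Set (EuclideanSpace ℝ (Fin n)))
    (f : EuclideanSpace ℝ (Fin n) → ℝ) : Prop :=
  ∀ (z : EuclideanSpace ℝ (Fin n)) (r : ℝ), 0 < r → closedBall z r ⊆ Ω →
    IntegrableOn (fun x => |f x| ^ p) (ball z r) volume ∧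
    BddAbove (besovSet n p α (ball z r) f)

section PartA

lemma aux_rpow_scalar {q s t : ℝ} (hq1 : 1 < q) (hq2 : q < 2) (ht : 0 ≤ t) (hts : t ≤ s) :
    (q - 1) * (s ^ (q / 2) - t ^ (q / 2)) ^ 2 ≤ (s ^ (q - 1) - t ^ (q - 1)) * (s - t) := by
  rcases eq_or_lt_of_le (ht.trans hts) with hs | hs
  · have : t = s := le_antisymm hts (hs ▸ ht)
    subst this; simp
  -- `t = s * y`
  obtain ⟨y, rfl⟩ : ∃ y, t = s * y := ⟨t / s, by field_simp⟩
  have hy0 : 0 ≤ y := by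
    by_contra h; push Not at h; nlinarith
  have hy1 : y ≤ 1 := by
    by_contra h; push Not at h; nlinarith
  have h1 : y ^ (q - 1) ≤ 1 + (q - 1) * (y - 1) := by
    have := rpow_one_add_le_one_add_mul_self (s := y - 1) (p := q - 1) (by linarith) (by linarith) (by linarith)
    simpa using this
  have h2 : y ≤ y ^ (q / 2) := by
    have := Real.rpow_le_rpow_of_exponent_ge_of_imp hy0 hy1 (show q / 2 ≤ 1 by linarith) (by intro _ h; linarith)
    simpa using this
  have h3 : y ^ (q / 2) ≤ 1 := Real.rpow_le_one hy0 hy1 (by linarith)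
  rw [Real.mul_rpow hs.le hy0, Real.mul_rpow hs.le hy0]
  have h4 : (s ^ (q / 2)) ^ 2 = s ^ q := by
    rw [← Real.rpow_natCast, ← Real.rpow_mul hs.le]; congr 1; push_cast; ring
  have h5 : s ^ (q - 1) * s = s ^ q := by
    rw [← Real.rpow_add_one hs.ne']; congr 1; ring
  have e1 : (q - 1) * (s ^ (q / 2) - s ^ (q / 2) * y ^ (q / 2)) ^ 2
      = s ^ q * ((q - 1) * (1 - y ^ (q / 2)) ^ 2) := by rw [← h4]; ring
  have e2 : (s ^ (q - 1) - s ^ (q - 1) * y ^ (q - 1)) * (s - s * y)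
      = s ^ q * ((1 - y ^ (q - 1)) * (1 - y)) := by rw [← h5]; ring
  rw [e1, e2]
  apply mul_le_mul_of_nonneg_left _ (Real.rpow_nonneg hs.le _)
  have h6 : (1 - y ^ (q / 2)) ^ 2 ≤ (1 - y) ^ 2 := by
    apply pow_le_pow_left₀ <;> linarith
  nlinarith

lemma aux_rpow_scalar' {q s t : ℝ} (hq1 : 1 < q) (hq2 : q < 2) (hs : 0 ≤ s) (ht : 0 ≤ t) :
    (q - 1) * (s ^ (q / 2) - t ^ (q / 2)) ^ 2 ≤ (s ^ (q - 1) - t ^ (q - 1)) * (s - t) := by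
  rcases le_total t s with h | h
  · exact aux_rpow_scalar hq1 hq2 ht h
  · have := aux_rpow_scalar hq1 hq2 hs h
    nlinarith

lemma aux_half_sq {q s : ℝ} (hs : 0 ≤ s) : (s ^ (q / 2)) ^ 2 = s ^ q := by
  rw [← Real.rpow_natCast, ← Real.rpow_mul hs]; congr 1; push_cast; ring

lemma aux_sub_one_mul {q s : ℝ} (hq1 : 1 < q) (hs : 0 ≤ s) : s ^ (q - 1) * s = s ^ q := by
  rw [← Real.rpow_add_one' hs (by linarith)]; congr 1; ring

variable {W : Type*} [NormedAddCommGroup W] [InnerProductSpace ℝ W]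

lemma aux_mono_unit {q s t : ℝ} (hq1 : 1 < q) (hq2 : q < 2) (hs : 0 ≤ s) (ht : 0 ≤ t)
    (a b : W) (ha : ‖a‖ = 1) (hb : ‖b‖ = 1) :
    (q - 1) * ‖s ^ (q / 2) • a - t ^ (q / 2) • b‖ ^ 2 ≤
      ⟪s ^ (q - 1) • a - t ^ (q - 1) • b, (1 + s) • a - (1 + t) • b⟫ := by
  have h1 := aux_rpow_scalar' hq1 hq2 hs ht
  have hS := aux_half_sq (q := q) hs
  have hT := aux_half_sq (q := q) ht
  have hA := aux_sub_one_mul hq1 hs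
  have hB := aux_sub_one_mul hq1 ht
  have hA0 := Real.rpow_nonneg hs (q - 1)
  have hB0 := Real.rpow_nonneg ht (q - 1)
  have hS0 := Real.rpow_nonneg hs (q / 2)
  have hT0 := Real.rpow_nonneg ht (q / 2)
  set A := s ^ (q - 1)
  set B := t ^ (q - 1)
  set S := s ^ (q / 2)
  set T := t ^ (q / 2)
  have hk : |⟪a, b⟫| ≤ 1 := by
    have := abs_real_inner_le_norm a b; rwa [ha, hb, one_mul] at this
  obtain ⟨hk1, hk2⟩ := abs_le.1 hk
  have hprod : (2 * (S * T)) ^ 2 ≤ (A * t + B * s) ^ 2 := by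
    have : (S * T) ^ 2 = (A * t) * (B * s) := by
      rw [mul_pow, hS, hT, ← hA, ← hB]; ring
    nlinarith [sq_nonneg (A * t - B * s)]
  have hST : 2 * (S * T) ≤ A * t + B * s :=
    le_of_sq_le_sq hprod (by positivity)
  have e1 : ‖S • a - T • b‖ ^ 2 = S ^ 2 + T ^ 2 - 2 * (S * T) * ⟪a, b⟫ := by
    rw [norm_sub_sq_real, norm_smul, norm_smul, ha, hb, real_inner_smul_left, real_inner_smul_right]
    simp; ring
  have e2 : ⟪A • a - B • b, (1 + s) • a - (1 + t) • b⟫ =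
      A * s + B * t - ⟪a, b⟫ * (A * t + B * s) + (A + B) * (1 - ⟪a, b⟫) := by
    simp only [inner_sub_left, inner_sub_right, real_inner_smul_left, real_inner_smul_right,
      real_inner_self_eq_norm_sq, ha, hb, real_inner_comm a b]
    ring
  rw [e1, e2]
  generalize ⟪a, b⟫ = k at *
  have f1 : (q - 1) * (S ^ 2 + T ^ 2 - 2 * (S * T)) ≤ A * s + B * t - (A * t + B * s) := by
    nlinarith
  have f2 : (q - 1) * (S ^ 2 + T ^ 2 + 2 * (S * T)) ≤ A * s + B * t + (A * t + B * s) := by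
    have : 0 ≤ S ^ 2 + T ^ 2 + 2 * (S * T) := by positivity
    nlinarith
  have f3 : 0 ≤ (A + B) * (1 - k) := mul_nonneg (by positivity) (by linarith)
  nlinarith [mul_le_mul_of_nonneg_left f1 (show 0 ≤ (1 + k) / 2 by linarith),
    mul_le_mul_of_nonneg_left f2 (show 0 ≤ (1 - k) / 2 by linarith)]

lemma aux_holder_unit {γ S T : ℝ} (hγ0 : 0 < γ) (hγ1 : γ ≤ 1) (hT : 0 ≤ T) (hTS : T ≤ S)
    (a b : W) (ha : ‖a‖ = 1) (hb : ‖b‖ = 1) :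
    ‖S ^ γ • a - T ^ γ • b‖ ≤ 3 * ‖S • a - T • b‖ ^ γ := by
  have hS : 0 ≤ S := hT.trans hTS
  have hab : ‖a - b‖ ≤ 2 := by
    have := norm_sub_le a b; linarith
  have e1 : ‖S • a - T • b‖ ^ 2 = (S - T) ^ 2 + S * T * ‖a - b‖ ^ 2 := by
    rw [norm_sub_sq_real, norm_sub_sq_real, norm_smul, norm_smul, ha, hb, real_inner_smul_left,
      real_inner_smul_right]
    simp; ring
  have h1 : S - T ≤ ‖S • a - T • b‖ := by
    apply le_of_sq_le_sq _ (norm_nonneg _)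
    rw [e1]; have : 0 ≤ S * T * ‖a - b‖ ^ 2 := by positivity
    linarith
  have h2 : T * ‖a - b‖ ≤ ‖S • a - T • b‖ := by
    apply le_of_sq_le_sq _ (norm_nonneg _)
    rw [e1]
    have : T * T * ‖a - b‖ ^ 2 ≤ S * T * ‖a - b‖ ^ 2 := by gcongr
    nlinarith [sq_nonneg (S - T)]
  have h3 : S ^ γ - T ^ γ ≤ ‖S • a - T • b‖ ^ γ := by
    have := Real.rpow_add_le_add_rpow hT (sub_nonneg.2 hTS) hγ0.le hγ1
    have h4 := Real.rpow_le_rpow (sub_nonneg.2 hTS) h1 hγ0.le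
    rw [show T + (S - T) = S by ring] at this
    linarith
  have h4 : T ^ γ * ‖a - b‖ ≤ 2 * ‖S • a - T • b‖ ^ γ := by
    have h5 : ‖a - b‖ / 2 ≤ (‖a - b‖ / 2) ^ γ := by
      have := Real.rpow_le_rpow_of_exponent_ge_of_imp (show 0 ≤ ‖a - b‖ / 2 by positivity)
        (by linarith) hγ1 (by intro _ h; exact absurd h one_ne_zero)
      simpa using this
    have h6 : (T * (‖a - b‖ / 2)) ^ γ ≤ ‖S • a - T • b‖ ^ γ := by
      apply Real.rpow_le_rpow (by positivity) _ hγ0.le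
      have : 0 ≤ T * ‖a - b‖ := by positivity
      linarith
    rw [Real.mul_rpow hT (by positivity)] at h6
    have := mul_le_mul_of_nonneg_left h5 (Real.rpow_nonneg hT γ)
    linarith
  calc ‖S ^ γ • a - T ^ γ • b‖ = ‖(S ^ γ - T ^ γ) • a + T ^ γ • (a - b)‖ := by
        congr 1; rw [sub_smul, smul_sub]; abel
    _ ≤ ‖(S ^ γ - T ^ γ) • a‖ + ‖T ^ γ • (a - b)‖ := norm_add_le _ _
    _ = (S ^ γ - T ^ γ) + T ^ γ * ‖a - b‖ := by
        rw [norm_smul, norm_smul, ha, Real.norm_of_nonneg (Real.rpow_nonneg hT γ),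
          Real.norm_of_nonneg (sub_nonneg.2 (Real.rpow_le_rpow hT hTS hγ0.le)), mul_one]
    _ ≤ _ := by linarith

lemma aux_holder_unit' {γ S T : ℝ} (hγ0 : 0 < γ) (hγ1 : γ ≤ 1) (hS : 0 ≤ S) (hT : 0 ≤ T)
    (a b : W) (ha : ‖a‖ = 1) (hb : ‖b‖ = 1) :
    ‖S ^ γ • a - T ^ γ • b‖ ≤ 3 * ‖S • a - T • b‖ ^ γ := by
  rcases le_total T S with h | h
  · exact aux_holder_unit hγ0 hγ1 hT h a b ha hb
  · rw [norm_sub_rev, norm_sub_rev (S • a)]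
    exact aux_holder_unit hγ0 hγ1 hS h b a hb ha

variable {n : ℕ}

lemma Hmap_of_le {a : ℝ} (ha : 0 < a) {ξ : EuclideanSpace ℝ (Fin n)} (h : ‖ξ‖ ≤ 1) :
    Hmap n a ξ = 0 := by
  rw [Hmap, max_eq_right (by linarith), Real.zero_rpow ha.ne']; simp

lemma Hmap_of_gt {a : ℝ} {ξ : EuclideanSpace ℝ (Fin n)} (h : 1 < ‖ξ‖) :
    Hmap n a ξ = (‖ξ‖ - 1) ^ a • (‖ξ‖⁻¹ • ξ) := by
  rw [Hmap, max_eq_left (by linarith), smul_smul, div_eq_mul_inv]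

lemma norm_Hmap {a : ℝ} (ha : 0 < a) (ξ : EuclideanSpace ℝ (Fin n)) :
    ‖Hmap n a ξ‖ = (max (‖ξ‖ - 1) 0) ^ a := by
  rcases le_or_gt ‖ξ‖ 1 with h | h
  · rw [Hmap_of_le ha h, max_eq_right (by linarith), Real.zero_rpow ha.ne', norm_zero]
  · rw [Hmap_of_gt h, max_eq_left (by linarith), norm_smul, norm_smul, norm_inv, norm_norm,
      inv_mul_cancel₀ (by linarith), mul_one, Real.norm_of_nonneg (Real.rpow_nonneg (by linarith) _)]

lemma Hmap_mono {q : ℝ} (hq1 : 1 < q) (hq2 : q < 2) (ξ η : EuclideanSpace ℝ (Fin n)) :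
    (q - 1) * ‖Hmap n (q / 2) ξ - Hmap n (q / 2) η‖ ^ 2 ≤
      ⟪Hmap n (q - 1) ξ - Hmap n (q - 1) η, ξ - η⟫ := by
  have key : ∀ ξ η : EuclideanSpace ℝ (Fin n), ‖ξ‖ ≤ 1 → 1 < ‖η‖ →
      (q - 1) * ‖Hmap n (q / 2) η‖ ^ 2 ≤ ⟪Hmap n (q - 1) η, η - ξ⟫ := by
    intro ξ η h h'
    rw [norm_Hmap (by linarith), max_eq_left (by linarith), aux_half_sq (by linarith),
      Hmap_of_gt h']
    have hη : ‖η‖ ≠ 0 := by linarith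
    rw [inner_sub_right, real_inner_smul_left, real_inner_smul_left, real_inner_smul_left,
      real_inner_smul_left, real_inner_self_eq_norm_sq]
    have h1 : ‖η‖⁻¹ * ⟪η, ξ⟫ ≤ 1 := by
      have := real_inner_le_norm η ξ
      rw [inv_mul_le_iff₀ (by linarith)]; nlinarith
    have h2 : ‖η‖⁻¹ * ‖η‖ ^ 2 = ‖η‖ := by field_simp
    rw [h2, ← aux_sub_one_mul hq1 (by linarith : (0:ℝ) ≤ ‖η‖ - 1)]
    have h0 := Real.rpow_nonneg (by linarith : (0:ℝ) ≤ ‖η‖ - 1) (q - 1)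
    generalize (‖η‖ - 1) ^ (q - 1) = A at *
    generalize ‖η‖⁻¹ * ⟪η, ξ⟫ = k at *
    have : 0 ≤ A * (‖η‖ - 1) := mul_nonneg h0 (by linarith)
    nlinarith
  rcases le_or_gt ‖ξ‖ 1 with h | h <;> rcases le_or_gt ‖η‖ 1 with h' | h'
  · simp [Hmap_of_le (show 0 < q / 2 by linarith) h, Hmap_of_le (show 0 < q / 2 by linarith) h',
      Hmap_of_le (show 0 < q - 1 by linarith) h, Hmap_of_le (show 0 < q - 1 by linarith) h']
  · have := key ξ η h h'
    rw [Hmap_of_le (show 0 < q / 2 by linarith) h, Hmap_of_le (show 0 < q - 1 by linarith) h,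
      zero_sub, zero_sub, norm_neg, ← neg_sub η ξ, inner_neg_neg]
    exact this
  · have := key η ξ h' h
    rw [Hmap_of_le (show 0 < q / 2 by linarith) h', Hmap_of_le (show 0 < q - 1 by linarith) h',
      sub_zero, sub_zero]
    exact this
  · rw [Hmap_of_gt h, Hmap_of_gt h', Hmap_of_gt h, Hmap_of_gt h']
    have := aux_mono_unit hq1 hq2 (show 0 ≤ ‖ξ‖ - 1 by linarith) (show 0 ≤ ‖η‖ - 1 by linarith)
      (‖ξ‖⁻¹ • ξ) (‖η‖⁻¹ • η) (by rw [norm_smul, norm_inv, norm_norm, inv_mul_cancel₀ (by linarith)])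
      (by rw [norm_smul, norm_inv, norm_norm, inv_mul_cancel₀ (by linarith)])
    rwa [add_sub_cancel, add_sub_cancel, smul_inv_smul₀ (by linarith : ‖ξ‖ ≠ 0),
      smul_inv_smul₀ (by linarith : ‖η‖ ≠ 0)] at this

lemma Hmap_holder {q p : ℝ} (hq1 : 1 < q) (hq2 : q < 2) (hp : p = q / (q - 1))
    (ξ η : EuclideanSpace ℝ (Fin n)) :
    ‖Hmap n (q - 1) ξ - Hmap n (q - 1) η‖ ^ p ≤
      3 ^ p * ‖Hmap n (q / 2) ξ - Hmap n (q / 2) η‖ ^ 2 := by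
  have hp0 : 0 < p := by rw [hp]; exact div_pos (by linarith) (by linarith)
  have hpq : p * (q - 1) = q := by rw [hp]; exact div_mul_cancel₀ _ (by linarith)
  suffices h : ‖Hmap n (q - 1) ξ - Hmap n (q - 1) η‖ ≤
      3 * ‖Hmap n (q / 2) ξ - Hmap n (q / 2) η‖ ^ (2 / p) by
    calc _ ≤ (3 * ‖Hmap n (q / 2) ξ - Hmap n (q / 2) η‖ ^ (2 / p)) ^ p :=
          Real.rpow_le_rpow (norm_nonneg _) h hp0.le
      _ = _ := by
          rw [Real.mul_rpow (by norm_num) (by positivity), ← Real.rpow_mul (norm_nonneg _),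
            div_mul_cancel₀ _ hp0.ne']; norm_num
  have hγ : q / 2 * (2 / p) = q - 1 := by
    rw [div_mul_div_comm, mul_comm 2 p, mul_div_mul_right _ _ two_ne_zero, div_eq_iff hp0.ne']
    linarith
  have hγ0 : 0 < 2 / p := by positivity
  have hγ1 : 2 / p ≤ 1 := by
    rw [div_le_one hp0]; nlinarith
  have key : ∀ ξ η : EuclideanSpace ℝ (Fin n), ‖ξ‖ ≤ 1 → 
      ‖Hmap n (q - 1) η‖ ≤ 3 * ‖Hmap n (q / 2) η‖ ^ (2 / p) := by
    intro ξ η h 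
    rw [norm_Hmap (by linarith), norm_Hmap (by linarith), ← Real.rpow_mul (le_max_right _ _), hγ]
    have := Real.rpow_nonneg (le_max_right (‖η‖ - 1) 0) (q - 1)
    linarith
  rcases le_or_gt ‖ξ‖ 1 with h | h
  · rw [Hmap_of_le (show 0 < q / 2 by linarith) h, Hmap_of_le (show 0 < q - 1 by linarith) h,
      zero_sub, zero_sub, norm_neg, norm_neg]
    exact key ξ η h
  · rcases le_or_gt ‖η‖ 1 with h' | h'
    · rw [Hmap_of_le (show 0 < q / 2 by linarith) h', Hmap_of_le (show 0 < q - 1 by linarith) h',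
        sub_zero, sub_zero]
      exact key η ξ h'
    · rw [Hmap_of_gt h, Hmap_of_gt h', Hmap_of_gt h, Hmap_of_gt h']
      have hx : 0 ≤ ‖ξ‖ - 1 := by linarith
      have hy : 0 ≤ ‖η‖ - 1 := by linarith
      have := aux_holder_unit' hγ0 hγ1 (Real.rpow_nonneg hx (q / 2)) (Real.rpow_nonneg hy (q / 2))
        (‖ξ‖⁻¹ • ξ) (‖η‖⁻¹ • η)
        (by rw [norm_smul, norm_inv, norm_norm, inv_mul_cancel₀ (by linarith)])
        (by rw [norm_smul, norm_inv, norm_norm, inv_mul_cancel₀ (by linarith)])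
      rwa [← Real.rpow_mul hx, ← Real.rpow_mul hy, hγ] at this

end PartA

section PartD

lemma jensen_lintegral {X : Type*} [MeasurableSpace X] (μ : Measure X) [IsProbabilityMeasure μ]
    {g : X → ℝ≥0∞} (hg : AEMeasurable g μ) {q : ℝ} (hq : 1 ≤ q) :
    (∫⁻ x, g x ∂μ) ^ q ≤ ∫⁻ x, g x ^ q ∂μ := by
  have h := eLpNorm'_le_eLpNorm'_of_exponent_le (f := g) one_pos hq μ hg.aestronglyMeasurable
  simp only [eLpNorm', enorm_eq_self, ENNReal.rpow_one, div_one] at h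
  calc _ ≤ ((∫⁻ x, g x ^ q ∂μ) ^ (1 / q)) ^ q := ENNReal.rpow_le_rpow h (by linarith)
    _ = _ := by
      rw [← ENNReal.rpow_mul, one_div_mul_cancel (by linarith), ENNReal.rpow_one]

/-- Jensen on a set of finite positive measure. -/
lemma jensen_setAverage {X : Type*} [MeasurableSpace X] {μ : Measure X} {S : Set X}
    (h0 : μ S ≠ 0) (h1 : μ S ≠ ∞) {w : X → ℝ} (hw : IntegrableOn w S μ) (c : ℝ) :
    ‖(⨍ x in S, w x ∂μ) - c‖ₑ ^ 2 ≤ (μ S)⁻¹ * ∫⁻ x in S, ‖w x - c‖ₑ ^ 2 ∂μ := by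
  have : IsProbabilityMeasure ((μ S)⁻¹ • μ.restrict S) := ⟨by
    simp [ENNReal.inv_mul_cancel h0 h1]⟩
  have e0 : (⨍ x in S, w x ∂μ) - c = ∫ x, (w x - c) ∂((μ S)⁻¹ • μ.restrict S) := by
    rw [integral_sub]
    · simp [setAverage_eq']
    · exact hw.smul_measure (ENNReal.inv_ne_top.2 h0)
    · exact integrable_const _
  have hm : AEMeasurable (fun x => ‖w x - c‖ₑ) ((μ S)⁻¹ • μ.restrict S) :=
    ((hw.1.sub aestronglyMeasurable_const).enorm).smul_measure _
  have := jensen_lintegral _ hm (q := 2) (by norm_num)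
  rw [e0]
  calc _ ≤ (∫⁻ x, ‖w x - c‖ₑ ∂((μ S)⁻¹ • μ.restrict S)) ^ 2 := by
        gcongr; exact enorm_integral_le_lintegral_enorm _
    _ ≤ ∫⁻ x, ‖w x - c‖ₑ ^ 2 ∂((μ S)⁻¹ • μ.restrict S) := by exact_mod_cast this
    _ = _ := by rw [lintegral_smul_measure, smul_eq_mul]

variable {n : ℕ}

local notation "𝔼" => EuclideanSpace ℝ (Fin n)

lemma vol_ball_eq (hn : 0 < n) (x : 𝔼) {ρ : ℝ} (hρ : 0 ≤ ρ) :
    volume (ball x ρ) = ENNReal.ofReal (ρ ^ n) * volume (ball (0 : 𝔼) 1) := by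
  have : Nonempty (Fin n) := ⟨⟨0, hn⟩⟩
  rw [Measure.addHaar_ball volume x hρ]; simp

/-- the inner integral shift -/
lemma lintegral_ball_shift (F : 𝔼 → ℝ≥0∞) (a x : 𝔼) (ρ : ℝ) (R : ℝ) (h : dist a x + ρ ≤ R) :
    ∫⁻ b in ball x ρ, F b ≤ ∫⁻ h in ball (0 : 𝔼) R, F (a + h) := by
  rw [← lintegral_indicator measurableSet_ball, ← lintegral_indicator measurableSet_ball,
    ← lintegral_add_left_eq_self _ a]
  apply lintegral_mono
  intro y
  by_cases hy : a + y ∈ ball x ρ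
  · have : y ∈ ball (0 : 𝔼) R := by
      rw [mem_ball_zero_iff]
      rw [mem_ball, dist_eq_norm] at hy
      rw [dist_eq_norm] at h
      calc ‖y‖ = ‖(a + y - x) - (a - x)‖ := by congr 1; abel
        _ ≤ ‖a + y - x‖ + ‖a - x‖ := norm_sub_le _ _
        _ < R := by linarith
    simp [hy, this]
  · simp [hy]

lemma embed_D1 (hn : 0 < n) {w : 𝔼 → ℝ} (hw : Measurable w) {z : 𝔼} {r θ C : ℝ} 
    (hθ : 0 < θ) (hC : 0 ≤ C)
    (hd : ∀ h : 𝔼, ‖h‖ ≤ r → ∫⁻ x in ball z (2 * r), ‖w (x + h) - w x‖ₑ ^ 2 ≤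
      ENNReal.ofReal (C * ‖h‖ ^ (2 * θ)))
    {x : 𝔼} {ρ : ℝ} (hx : x ∈ ball z r) (hρ0 : 0 < ρ) (hρ : 2 * ρ ≤ r) :
    ∫⁻ a in ball x ρ, ∫⁻ b in ball x ρ, ‖w b - w a‖ₑ ^ 2 ≤
      volume (ball (0 : 𝔼) (2 * ρ)) * ENNReal.ofReal (C * (2 * ρ) ^ (2 * θ)) := by
  have hmeas : Measurable (fun p : 𝔼 × 𝔼 => ‖w (p.1 + p.2) - w p.1‖ₑ ^ 2) := by fun_prop
  calc _ ≤ ∫⁻ a in ball x ρ, ∫⁻ h in ball (0 : 𝔼) (2 * ρ), ‖w (a + h) - w a‖ₑ ^ 2 := by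
        apply setLIntegral_mono' measurableSet_ball
        intro a ha
        apply lintegral_ball_shift (fun b => ‖w b - w a‖ₑ ^ 2) 
        rw [mem_ball] at ha; linarith
    _ = ∫⁻ h in ball (0 : 𝔼) (2 * ρ), ∫⁻ a in ball x ρ, ‖w (a + h) - w a‖ₑ ^ 2 := by
        rw [lintegral_lintegral_swap]
        exact hmeas.aemeasurable
    _ ≤ ∫⁻ h in ball (0 : 𝔼) (2 * ρ), ENNReal.ofReal (C * (2 * ρ) ^ (2 * θ)) := by
        apply setLIntegral_mono' measurableSet_ball
        intro h hh
        rw [mem_ball_zero_iff] at hh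
        calc _ ≤ ∫⁻ a in ball z (2 * r), ‖w (a + h) - w a‖ₑ ^ 2 := by
              apply lintegral_mono_set
              apply ball_subset_ball'
              rw [mem_ball] at hx; linarith
          _ ≤ _ := hd h (by linarith)
          _ ≤ _ := by gcongr
    _ = _ := by simp [mul_comm]

lemma embed_D4 (hn : 0 < n) {w : 𝔼 → ℝ} (hw : Measurable w) {z : 𝔼} {r θ C : ℝ} 
    (hr : 0 < r) (hθ : 0 < θ) (hC : 0 ≤ C)
    (hd : ∀ h : 𝔼, ‖h‖ ≤ r → ∫⁻ x in ball z (2 * r), ‖w (x + h) - w x‖ₑ ^ 2 ≤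
      ENNReal.ofReal (C * ‖h‖ ^ (2 * θ)))
    {ρ : ℝ}  (hρ0 : 0 < ρ) (hρ : 2 * ρ ≤ r) :
    ∫⁻ a in ball z r, (volume (ball (0 : 𝔼) ρ))⁻¹ * ∫⁻ h in ball (0 : 𝔼) ρ, ‖w (a + h) - w a‖ₑ ^ 2 
     ≤ ENNReal.ofReal (C * ρ ^ (2 * θ)) := by
  have hmeas : Measurable (fun p : 𝔼 × 𝔼 => ‖w (p.1 + p.2) - w p.1‖ₑ ^ 2) := by fun_prop
  have hv0 : volume (ball (0 : 𝔼) ρ) ≠ 0 := (measure_ball_pos _ _ hρ0).ne'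
  have hv1 : volume (ball (0 : 𝔼) ρ) ≠ ∞ := measure_ball_lt_top.ne
  rw [lintegral_const_mul _ (by exact hmeas.lintegral_prod_right'), ENNReal.inv_mul_le_iff hv0 hv1]
  calc _ = ∫⁻ h in ball (0 : 𝔼) ρ, ∫⁻ a in ball z r, ‖w (a + h) - w a‖ₑ ^ 2 := by
        rw [lintegral_lintegral_swap]
        exact hmeas.aemeasurable
    _ ≤ ∫⁻ h in ball (0 : 𝔼) ρ, ENNReal.ofReal (C * ρ ^ (2 * θ)) := by
        apply setLIntegral_mono' measurableSet_ball
        intro h hh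
        rw [mem_ball_zero_iff] at hh
        calc _ ≤ ∫⁻ a in ball z (2 * r), ‖w (a + h) - w a‖ₑ ^ 2 := by
              apply lintegral_mono_set
              apply ball_subset_ball
              linarith
          _ ≤ _ := hd h (by linarith)
          _ ≤ _ := by gcongr
    _ = _ := by simp [mul_comm]

lemma embed_D2 (hn : 0 < n) {w : 𝔼 → ℝ} (hw : Measurable w) (hwL : LocallyIntegrable w)
     {z : 𝔼} {r θ C : ℝ} 
    (hθ : 0 < θ) (hC : 0 ≤ C)
    (hd : ∀ h : 𝔼, ‖h‖ ≤ r → ∫⁻ x in ball z (2 * r), ‖w (x + h) - w x‖ₑ ^ 2 ≤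
      ENNReal.ofReal (C * ‖h‖ ^ (2 * θ)))
    {x : 𝔼} {ρ : ℝ} (hx : x ∈ ball z r) (hρ0 : 0 < ρ) (hρ : 2 * ρ ≤ r) :
    ‖(⨍ y in ball x (ρ / 2), w y) - ⨍ y in ball x ρ, w y‖ₑ ^ 2 ≤
      (volume (ball x (ρ / 2)))⁻¹ * ((volume (ball x ρ))⁻¹ *
        (volume (ball (0 : 𝔼) (2 * ρ)) * ENNReal.ofReal (C * (2 * ρ) ^ (2 * θ)))) := by
  have hi : ∀ ρ, IntegrableOn w (ball x ρ) := fun ρ =>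
    (hwL.integrableOn_isCompact (isCompact_closedBall x ρ)).mono_set ball_subset_closedBall
  have hv0 : ∀ ρ, 0 < ρ → volume (ball x ρ) ≠ 0 := fun ρ h => (measure_ball_pos _ _ h).ne'
  have hv1 : ∀ ρ, volume (ball x ρ) ≠ ∞ := fun ρ => measure_ball_lt_top.ne
  refine (jensen_setAverage (hv0 _ (by linarith)) (hv1 _) (hi _) _).trans ?_
  gcongr
  calc _ ≤ ∫⁻ a in ball x ρ, ‖w a - ⨍ y in ball x ρ, w y‖ₑ ^ 2 := by
        apply lintegral_mono_set; apply ball_subset_ball; linarith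
    _ ≤ ∫⁻ a in ball x ρ, (volume (ball x ρ))⁻¹ * ∫⁻ b in ball x ρ, ‖w b - w a‖ₑ ^ 2 := by
        apply lintegral_mono
        intro a
        have := jensen_setAverage (hv0 ρ hρ0) (hv1 ρ) (hi ρ) (w a)
        rwa [← enorm_neg, neg_sub] at this
    _ = (volume (ball x ρ))⁻¹ * ∫⁻ a in ball x ρ, ∫⁻ b in ball x ρ, ‖w b - w a‖ₑ ^ 2 := by
        rw [lintegral_const_mul']
        exact ENNReal.inv_ne_top.2 (hv0 ρ hρ0)
    _ ≤ _ := by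
        gcongr
        exact embed_D1 hn hw hθ hC hd hx hρ0 hρ

end PartD

section PartD2
variable {n : ℕ}

local notation "𝔼" => EuclideanSpace ℝ (Fin n)

lemma embed_D2' (hn : 0 < n) {w : 𝔼 → ℝ} (hw : Measurable w) (hwL : LocallyIntegrable w)
     {z : 𝔼} {r θ C : ℝ} (hr : 0 < r)
    (hθ : 0 < θ) (hC : 0 ≤ C)
    (hd : ∀ h : 𝔼, ‖h‖ ≤ r → ∫⁻ x in ball z (2 * r), ‖w (x + h) - w x‖ₑ ^ 2 ≤
      ENNReal.ofReal (C * ‖h‖ ^ (2 * θ))) :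
    ∃ P : ℝ, 0 ≤ P ∧ ∀ x ∈ ball z r, ∀ k : ℕ, 
    |(⨍ y in ball x (r / 2 / 2 ^ (k + 1)), w y) - ⨍ y in ball x (r / 2 / 2 ^ k), w y| ≤
      P * ((2 : ℝ) ^ ((n : ℝ) / 2 - θ)) ^ k := by
  set c := (volume (ball (0 : 𝔼) 1)).toReal with hc
  have hc0 : 0 < c := ENNReal.toReal_pos (measure_ball_pos _ _ one_pos).ne' measure_ball_lt_top.ne
  have hv : ∀ (x : 𝔼) (ρ : ℝ), 0 ≤ ρ → volume (ball x ρ) = ENNReal.ofReal (ρ ^ n * c) := by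
    intro x ρ h
    rw [vol_ball_eq hn x h, ENNReal.ofReal_mul (by positivity), hc, 
      ENNReal.ofReal_toReal measure_ball_lt_top.ne]
  set L := 4 ^ n * c⁻¹ * C * 2 ^ (2 * θ) with hL
  have hL0 : 0 ≤ L := by positivity
  set Q := L * ((r / 2) ^ (2 * θ) / (r / 2) ^ n) with hQ
  have hQ0 : 0 ≤ Q := by positivity
  refine ⟨√Q, Real.sqrt_nonneg _, fun x hx k => ?_⟩
  set ρ := r / 2 / 2 ^ k with hρ
  have hρ0 : 0 < ρ := by positivity
  have hρ1 : 2 * ρ ≤ r := by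
    have : ρ ≤ r / 2 := div_le_self (by positivity) (one_le_pow₀ (by norm_num))
    linarith
  have h := embed_D2 hn hw hwL hθ hC hd hx hρ0 hρ1
  rw [hv _ _ (by positivity), hv _ _ (by positivity), hv _ _ (by positivity),
    ← ENNReal.ofReal_inv_of_pos (by positivity), ← ENNReal.ofReal_inv_of_pos (by positivity),
    ← ENNReal.ofReal_mul (by positivity), ← ENNReal.ofReal_mul (by positivity), 
    ← ENNReal.ofReal_mul (by positivity), ← ofReal_norm, ← ENNReal.ofReal_pow (norm_nonneg _),
    ENNReal.ofReal_le_ofReal_iff (by positivity)] at h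
  have e1 : ((ρ / 2) ^ n * c)⁻¹ * ((ρ ^ n * c)⁻¹ * ((2 * ρ) ^ n * c * (C * (2 * ρ) ^ (2 * θ)))) =
      L * (ρ ^ (2 * θ) / ρ ^ n) := by
    rw [hL, Real.mul_rpow (by norm_num) hρ0.le, div_pow, mul_pow, show (4 : ℝ) ^ n = 2 ^ n * 2 ^ n by
      rw [← mul_pow]; norm_num]
    field_simp
  have e2 : L * (ρ ^ (2 * θ) / ρ ^ n) = (√Q * ((2 : ℝ) ^ ((n : ℝ) / 2 - θ)) ^ k) ^ 2 := by
    rw [mul_pow, Real.sq_sqrt hQ0, hQ, mul_assoc L]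
    congr 1
    rw [hρ, Real.div_rpow (by positivity) (by positivity), div_pow (r / 2), ← pow_mul,
       ← pow_mul]
    have : ((2 : ℝ) ^ ((n : ℝ) / 2 - θ)) ^ (k * 2) = 2 ^ (k * n) / (2 ^ k) ^ (2 * θ) := by
      rw [← Real.rpow_natCast, ← Real.rpow_natCast, ← Real.rpow_natCast, ← Real.rpow_mul (by norm_num),
        ← Real.rpow_mul (by norm_num), ← Real.rpow_sub (by norm_num)]
      congr 1; push_cast; ring
    rw [this]
    field_simp
  rw [e1, e2] at h
  have := abs_le_of_sq_le_sq' h (by positivity)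
  rw [show r / 2 / 2 ^ (k + 1) = ρ / 2 by rw [hρ, pow_succ]; field_simp]
  rw [Real.norm_eq_abs] at this
  exact this.2

lemma embed_D3 (hn : 0 < n) {w : 𝔼 → ℝ} (hw : Measurable w) (hwL : MemLp w 2)
     {z : 𝔼} {r θ C : ℝ} (hr : 0 < r)
    (hθ : 0 < θ) (hθn : 2 * θ < n) (hC : 0 ≤ C)
    (hd : ∀ h : 𝔼, ‖h‖ ≤ r → ∫⁻ x in ball z (2 * r), ‖w (x + h) - w x‖ₑ ^ 2 ≤
      ENNReal.ofReal (C * ‖h‖ ^ (2 * θ))) :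
    ∃ M : ℝ, 0 < M ∧ ∀ x ∈ ball z r, ∀ k : ℕ, 
    |⨍ y in ball x (r / 2 / 2 ^ k), w y| ≤ M * ((2 : ℝ) ^ ((n : ℝ) / 2 - θ)) ^ k := by
  have hwL' : LocallyIntegrable w := hwL.locallyIntegrable (by norm_num)
  obtain ⟨P, hP, h⟩ := embed_D2' hn hw hwL' hr hθ hC hd
  set y := (2 : ℝ) ^ ((n : ℝ) / 2 - θ) with hy
  have hy1 : 1 < y := Real.one_lt_rpow (by norm_num) (by linarith)
  obtain ⟨M0, hM0, h0⟩ : ∃ M0 : ℝ, 0 ≤ M0 ∧ ∀ x : 𝔼, |⨍ y in ball x (r / 2), w y| ≤ M0 := by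
    set I := (volume (ball (0 : 𝔼) (r / 2)))⁻¹ * ∫⁻ x, ‖w x‖ₑ ^ 2 with hI
    have hv0 : ∀ x : 𝔼, volume (ball x (r / 2)) ≠ 0 := fun x => (measure_ball_pos _ _ (by positivity)).ne'
    have hv1 : ∀ x : 𝔼, volume (ball x (r / 2)) ≠ ∞ := fun ρ => measure_ball_lt_top.ne
    have hI' : I ≠ ∞ := by
      apply ENNReal.mul_ne_top (ENNReal.inv_ne_top.2 (hv0 _))
      have := hwL.2
      rw [eLpNorm_lt_top_iff_lintegral_rpow_enorm_lt_top (by norm_num) (by norm_num)] at this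
      simpa using this.ne
    refine ⟨√I.toReal, by positivity, fun x => ?_⟩
    have hi : IntegrableOn w (ball x (r / 2)) := 
      (hwL'.integrableOn_isCompact (isCompact_closedBall x _)).mono_set ball_subset_closedBall
    have := jensen_setAverage (hv0 x) (hv1 x) hi 0
    apply Real.le_sqrt_of_sq_le
    have h2 : ‖⨍ y in ball x (r / 2), w y‖ₑ ^ 2 ≤ I := by
      simp only [sub_zero] at this
      refine this.trans ?_
      rw [hI, vol_ball_eq hn x (by positivity), ← vol_ball_eq hn 0 (by positivity)]
      gcongr
      exact Measure.restrict_le_self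
    have h3 := ENNReal.toReal_mono hI' h2
    simpa using h3
  refine ⟨M0 + P / (y - 1) + 1, ?_, fun x hx k => ?_⟩
  · have : 0 ≤ P / (y - 1) := div_nonneg hP (by linarith)
    linarith
  have hq : 0 ≤ P / (y - 1) := div_nonneg hP (by linarith)
  have hPq : P = P / (y - 1) * (y - 1) := by
    rw [div_mul_cancel₀]; linarith
  induction k with
  | zero => 
    have := h0 x
    simp only [pow_zero, div_one, mul_one]
    linarith
  | succ k ih =>
    have h1 := h x hx k
    have h2 := abs_sub_abs_le_abs_sub (⨍ y in ball x (r / 2 / 2 ^ (k + 1)), w y) (⨍ y in ball x (r / 2 / 2 ^ k), w y)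
    have hyk : 0 < y ^ k := by positivity
    generalize P / (y - 1) = q at *
    subst hPq
    have hys : y ^ (k + 1) = y ^ k * y := pow_succ _ _
    have h3 : 0 ≤ (M0 + 1) * y ^ k * (y - 1) := by
      have : 0 ≤ y - 1 := by linarith
      positivity
    nlinarith

/-- Local Nikolskii type embedding. -/
lemma nikolskii_embed (hn : 0 < n) {w : 𝔼 → ℝ} (hw : Measurable w) (hwL : MemLp w 2)
     {z : 𝔼} {r θ C : ℝ} (hr : 0 < r)
    (hθ : 0 < θ) (hθn : 2 * θ < n) (hC : 0 ≤ C)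
    (hd : ∀ h : 𝔼, ‖h‖ ≤ r → ∫⁻ x in ball z (2 * r), ‖w (x + h) - w x‖ₑ ^ 2 ≤
      ENNReal.ofReal (C * ‖h‖ ^ (2 * θ))) {t : ℝ} (ht0 : 0 < t) (ht : t * ((n : ℝ) / 2 - θ) < n) :
    IntegrableOn (fun x => |w x| ^ t) (ball z r) := by
  have hwL' : LocallyIntegrable w := hwL.locallyIntegrable (by norm_num)
  obtain ⟨M, hM, hA⟩ := embed_D3 hn hw hwL hr hθ hθn hC hd
  set y := (2 : ℝ) ^ ((n : ℝ) / 2 - θ) with hy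
  have hy1 : 1 < y := Real.one_lt_rpow (by norm_num) (by linarith)
  have hy0 : 0 < y := by linarith
  -- level set measures
  set C' := C * (r / 2) ^ (2 * θ) / M ^ 2 with hC'
  have hlev : ∀ k : ℕ, volume.restrict (ball z r) {x | 2 * M * y ^ k ≤ |w x|} ≤
      ENNReal.ofReal (C' * ((2 ^ n)⁻¹) ^ k) := by
    intro k
    set ρ := r / 2 / 2 ^ k with hρ
    have hρ0 : 0 < ρ := by positivity
    have hρ1 : 2 * ρ ≤ r := by
      have : ρ ≤ r / 2 := div_le_self (by positivity) (one_le_pow₀ (by norm_num))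
      linarith
    have h4 := embed_D4 hn hw hr hθ hC hd hρ0 hρ1
    set g : 𝔼 → ℝ≥0∞ := fun a => (volume (ball (0 : 𝔼) ρ))⁻¹ * 
      ∫⁻ h in ball (0 : 𝔼) ρ, ‖w (a + h) - w a‖ₑ ^ 2 with hg
    have hmeas : Measurable (fun p : 𝔼 × 𝔼 => ‖w (p.1 + p.2) - w p.1‖ₑ ^ 2) := by fun_prop
    have hgm : Measurable g := (hmeas.lintegral_prod_right').const_mul _
    have hsub : ∀ x ∈ ball z r, 2 * M * y ^ k ≤ |w x| → 
        ENNReal.ofReal ((M * y ^ k) ^ 2) ≤ g x := by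
      intro x hx hwx
      have h5 := hA x hx k
      have hi : IntegrableOn w (ball x ρ) := 
        (hwL'.integrableOn_isCompact (isCompact_closedBall x _)).mono_set ball_subset_closedBall
      have h6 := jensen_setAverage (measure_ball_pos _ _ hρ0).ne' measure_ball_lt_top.ne hi (w x)
      have h7 : ∫⁻ b in ball x ρ, ‖w b - w x‖ₑ ^ 2 ≤ ∫⁻ h in ball (0 : 𝔼) ρ, ‖w (x + h) - w x‖ₑ ^ 2 :=
        lintegral_ball_shift (fun b => ‖w b - w x‖ₑ ^ 2) x x ρ ρ (by simp)
      calc ENNReal.ofReal ((M * y ^ k) ^ 2) ≤ ‖(⨍ y in ball x ρ, w y) - w x‖ₑ ^ 2 := by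
            rw [← ofReal_norm, ← ENNReal.ofReal_pow (norm_nonneg _)]
            gcongr
            rw [Real.norm_eq_abs, abs_sub_comm]
            have := abs_sub_abs_le_abs_sub (w x) (⨍ y in ball x ρ, w y)
            linarith
        _ ≤ _ := h6
        _ ≤ g x := by
            rw [hg, vol_ball_eq hn x hρ0.le]
            simp only
            rw [vol_ball_eq hn 0 hρ0.le]
            gcongr
    have hpos : 0 < (M * y ^ k) ^ 2 := by positivity
    calc volume.restrict (ball z r) {x | 2 * M * y ^ k ≤ |w x|} 
        ≤ volume.restrict (ball z r) {x | ENNReal.ofReal ((M * y ^ k) ^ 2) ≤ g x} := by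
          apply measure_mono_ae
          filter_upwards [ae_restrict_mem measurableSet_ball] with x hx h
          exact hsub x hx h
      _ ≤ (∫⁻ x in ball z r, g x) / ENNReal.ofReal ((M * y ^ k) ^ 2) := 
          meas_ge_le_lintegral_div hgm.aemeasurable (ENNReal.ofReal_pos.2 hpos).ne' ENNReal.ofReal_ne_top
      _ ≤ ENNReal.ofReal (C * ρ ^ (2 * θ)) / ENNReal.ofReal ((M * y ^ k) ^ 2) := by gcongr
      _ = ENNReal.ofReal (C * ρ ^ (2 * θ) / (M * y ^ k) ^ 2) := by
          rw [ENNReal.ofReal_div_of_pos hpos]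
      _ = _ := by
          congr 1
          rw [hC', hρ, Real.div_rpow (by positivity) (by positivity), mul_pow, ← pow_mul]
          have : y ^ (k * 2) = (2 ^ n) ^ k / (2 ^ k) ^ (2 * θ) := by
            rw [← pow_mul, hy, ← Real.rpow_natCast, ← Real.rpow_natCast, ← Real.rpow_natCast,
              ← Real.rpow_mul (by norm_num),
              ← Real.rpow_mul (by norm_num), ← Real.rpow_sub (by norm_num)]
            congr 1; push_cast; ring
          rw [this, inv_pow]
          field_simp
  -- pointwise bound
  have hpt : ∀ x, ENNReal.ofReal (|w x| ^ t) ≤ ENNReal.ofReal ((2 * M) ^ t) + 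
      ∑' k : ℕ, {x | 2 * M * y ^ k ≤ |w x|}.indicator 
        (fun _ => ENNReal.ofReal ((2 * M * y ^ (k + 1)) ^ t)) x := by
    intro x
    rcases le_total (|w x|) (2 * M) with h | h
    · exact le_add_right (ENNReal.ofReal_le_ofReal (Real.rpow_le_rpow (abs_nonneg _) h ht0.le))
    · obtain ⟨k, hk1, hk2⟩ := exists_nat_pow_near (x := |w x| / (2 * M)) 
        ((one_le_div (by positivity)).2 h) hy1
      rw [le_div_iff₀ (by positivity)] at hk1
      rw [div_lt_iff₀ (by positivity)] at hk2
      refine le_add_left (le_trans ?_ (ENNReal.le_tsum k))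
      rw [Set.indicator_of_mem (by simp only [Set.mem_ofPred_eq]; linarith)]
      gcongr
      linarith
  have hlin : ∫⁻ x in ball z r, ENNReal.ofReal (|w x| ^ t) < ∞ := by
    have hms : ∀ k : ℕ, MeasurableSet {x | 2 * M * y ^ k ≤ |w x|} := fun k => 
      measurableSet_le measurable_const hw.abs
    calc _ ≤ ∫⁻ x in ball z r, (ENNReal.ofReal ((2 * M) ^ t) + 
      ∑' k : ℕ, {x | 2 * M * y ^ k ≤ |w x|}.indicator 
        (fun _ => ENNReal.ofReal ((2 * M * y ^ (k + 1)) ^ t)) x) := lintegral_mono hpt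
      _ = (∫⁻ x in ball z r, ENNReal.ofReal ((2 * M) ^ t)) + 
          ∑' k : ℕ, ENNReal.ofReal ((2 * M * y ^ (k + 1)) ^ t) * 
            volume.restrict (ball z r) {x | 2 * M * y ^ k ≤ |w x|} := by
          rw [lintegral_add_left measurable_const, lintegral_tsum]
          · congr 2; ext k
            rw [lintegral_indicator_const (hms k)]
          · intro k
            exact (measurable_const.indicator (hms k)).aemeasurable
      _ < ∞ := by
          apply ENNReal.add_lt_top.2
          refine ⟨by simpa using ENNReal.mul_lt_top ENNReal.ofReal_lt_top measure_ball_lt_top, ?_⟩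
          set s := y ^ t * (2 ^ n)⁻¹ with hs
          have hs0 : 0 ≤ s := by positivity
          have hs1 : s < 1 := by
            rw [hs, ← div_eq_mul_inv, div_lt_one (by positivity), hy, ← Real.rpow_mul (by norm_num), 
              ← Real.rpow_natCast 2 n]
            apply Real.rpow_lt_rpow_of_exponent_lt (by norm_num)
            linarith
          have hsum : Summable (fun k : ℕ => (2 * M * y) ^ t * C' * s ^ k) := 
            (summable_geometric_of_lt_one hs0 hs1).mul_left _
          calc _ ≤ ∑' k : ℕ, ENNReal.ofReal ((2 * M * y) ^ t * C' * s ^ k) := by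
                apply ENNReal.tsum_le_tsum
                intro k
                calc _ ≤ ENNReal.ofReal ((2 * M * y ^ (k + 1)) ^ t) * ENNReal.ofReal (C' * ((2 ^ n)⁻¹) ^ k) := by
                      gcongr; exact hlev k
                  _ = _ := by
                      rw [← ENNReal.ofReal_mul (by positivity)]
                      congr 1
                      have e : (2 * M * y ^ (k + 1)) ^ t = (2 * M * y) ^ t * (y ^ t) ^ k := by
                        rw [show 2 * M * y ^ (k + 1) = (2 * M * y) * y ^ k by ring,
                          Real.mul_rpow (by positivity) (by positivity), ← Real.rpow_natCast y k,
                          ← Real.rpow_natCast (y ^ t) k, ← Real.rpow_mul hy0.le,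
                          ← Real.rpow_mul hy0.le, mul_comm t]
                      rw [e, hs, mul_pow (y ^ t)]
                      ring
            _ < ∞ := by
                rw [← ENNReal.ofReal_tsum_of_nonneg _ hsum]
                · exact ENNReal.ofReal_lt_top
                · intro k; positivity
  refine ⟨(hw.abs.pow_const t).aestronglyMeasurable, ?_⟩
  rw [hasFiniteIntegral_iff_ofReal (Filter.Eventually.of_forall fun x => by positivity)]
  exact hlin

end PartD2

section PartM
open Filter Topology
open scoped Convolution

variable {n : ℕ}
local notation "𝔼" => EuclideanSpace ℝ (Fin n)

lemma tendsto_translate {F : Type*} [NormedAddCommGroup F] {q : ℝ≥0∞} (hq1 : 1 ≤ q) (hq2 : q ≠ ∞)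
    {g : 𝔼 → F} (hg : MemLp g q volume) :
    Tendsto (fun h : 𝔼 => eLpNorm (fun x => g (h + x) - g x) q volume) (𝓝 0) (𝓝 0) := by
  have : Fact (1 ≤ q) := ⟨hq1⟩
  have : Fact (q ≠ ∞) := ⟨hq2⟩
  have hc : Continuous (fun h : 𝔼 => (DomAddAct.mk h) +ᵥ (hg.toLp g)) := by
    have : Continuous (fun h : 𝔼 => DomAddAct.mk h) := DomAddAct.continuous_mk
    exact this.vadd continuous_const
  have h1 := (hc.tendsto 0).edist (tendsto_const_nhds (x := hg.toLp g))
  have e0 : (DomAddAct.mk (0 : 𝔼)) +ᵥ (hg.toLp g) = hg.toLp g := by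
    rw [DomAddAct.mk_vadd_toLp]
    congr 1; ext x; simp
  rw [e0, edist_self] at h1
  refine h1.congr fun h => ?_
  rw [DomAddAct.mk_vadd_toLp, Lp.edist_toLp_toLp]
  rfl

variable {F : Type*} [NormedAddCommGroup F] [NormedSpace ℝ F] [MeasurableSpace F] [BorelSpace F] [CompleteSpace F]
  [SecondCountableTopology F]

lemma mollify_bound {q : ℝ} (hq1 : 1 ≤ q) {g : 𝔼 → F} (hgm : Measurable g)
    (hg : LocallyIntegrable g volume) (φ : ContDiffBump (0 : 𝔼)) {δ : ℝ≥0∞}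
    (hδ : ∀ y : 𝔼, ‖y‖ ≤ φ.rOut → eLpNorm (fun x => g (y + x) - g x) (ENNReal.ofReal q) volume ≤ δ) :
    eLpNorm (fun x => (φ.normed volume ⋆[ContinuousLinearMap.lsmul ℝ ℝ, volume] g) x - g x)
      (ENNReal.ofReal q) volume ≤ δ := by
  have hq0 : 0 < q := by linarith
  have hqn : ENNReal.ofReal q ≠ 0 := by simpa using hq0
  set ρ := φ.normed volume with hρ
  set ν : Measure 𝔼 := volume.withDensity (fun y => ‖ρ y‖ₑ) with hν
  have hρm : Measurable (fun y => ‖ρ y‖ₑ) := φ.continuous_normed.measurable.enorm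
  have hprob : IsProbabilityMeasure ν := ⟨by
    rw [hν, withDensity_apply _ MeasurableSet.univ, Measure.restrict_univ]
    have h1 := φ.integral_normed (μ := (volume : Measure 𝔼))
    have h2 := ofReal_integral_norm_eq_lintegral_enorm (φ.integrable_normed (μ := (volume : Measure 𝔼)))
    rw [← h2]
    have : ∀ x, ‖φ.normed volume x‖ = φ.normed volume x := fun x => 
      Real.norm_of_nonneg (φ.nonneg_normed x)
    simp_rw [this, h1]; simp⟩
  have hmeas : Measurable (fun p : 𝔼 × 𝔼 => ‖g (p.1 - p.2) - g p.1‖ₑ ^ q) := by fun_prop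
  have hpt : ∀ x, ‖(ρ ⋆[ContinuousLinearMap.lsmul ℝ ℝ, volume] g) x - g x‖ₑ ^ q ≤ 
      ∫⁻ y, ‖g (x - y) - g x‖ₑ ^ q ∂ν := by
    intro x
    have hex := (φ.hasCompactSupport_normed (μ := (volume : Measure 𝔼))).convolutionExists_left 
      (ContinuousLinearMap.lsmul ℝ ℝ) (φ.continuous_normed) hg x
    have e1 : (ρ ⋆[ContinuousLinearMap.lsmul ℝ ℝ, volume] g) x - g x = ∫ y, ρ y • (g (x - y) - g x) := by
      simp_rw [smul_sub]
      rw [integral_sub, integral_smul_const, φ.integral_normed, one_smul]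
      · rfl
      · exact hex
      · exact φ.integrable_normed.smul_const _
    rw [e1]
    have h3 : ‖∫ y, ρ y • (g (x - y) - g x)‖ₑ ≤ ∫⁻ y, ‖g (x - y) - g x‖ₑ ∂ν := by
      refine (enorm_integral_le_lintegral_enorm _).trans (le_of_eq ?_)
      rw [hν, lintegral_withDensity_eq_lintegral_mul _ hρm (by fun_prop)]
      simp [enorm_smul]
    calc _ ≤ (∫⁻ y, ‖g (x - y) - g x‖ₑ ∂ν) ^ q := ENNReal.rpow_le_rpow h3 hq0.le
      _ ≤ _ := jensen_lintegral ν (Measurable.aemeasurable (by fun_prop)) hq1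
  have hsupp : ∀ᵐ y ∂ν, ‖y‖ ≤ φ.rOut := by
    rw [hν, ae_withDensity_iff hρm]
    refine Eventually.of_forall fun y hy => ?_
    have : y ∈ Function.support ρ := by simpa using hy
    rw [hρ, φ.support_normed_eq, mem_ball_zero_iff] at this
    exact this.le
  rw [eLpNorm_eq_lintegral_rpow_enorm_toReal hqn ENNReal.ofReal_ne_top, ENNReal.toReal_ofReal hq0.le]
  rw [one_div, ENNReal.rpow_inv_le_iff hq0]
  calc ∫⁻ x, ‖(ρ ⋆[ContinuousLinearMap.lsmul ℝ ℝ, volume] g) x - g x‖ₑ ^ q 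
      ≤ ∫⁻ x, ∫⁻ y, ‖g (x - y) - g x‖ₑ ^ q ∂ν := lintegral_mono hpt
    _ = ∫⁻ y, ∫⁻ x, ‖g (x - y) - g x‖ₑ ^ q ∂volume ∂ν := by
        rw [lintegral_lintegral_swap]; exact hmeas.aemeasurable
    _ ≤ ∫⁻ y, δ ^ q ∂ν := by
        apply lintegral_mono_ae
        filter_upwards [hsupp] with y hy
        have := hδ (-y) (by rwa [norm_neg])
        rw [eLpNorm_eq_lintegral_rpow_enorm_toReal hqn ENNReal.ofReal_ne_top, 
          ENNReal.toReal_ofReal hq0.le, one_div, ENNReal.rpow_inv_le_iff hq0] at this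
        simpa [neg_add_eq_sub] using this
    _ = δ ^ q := by simp

/-- standard sequence of bumps -/
noncomputable def bumpSeq (n : ℕ) (k : ℕ) : ContDiffBump (0 : EuclideanSpace ℝ (Fin n)) where
  rIn := 1 / (2 * ((k : ℝ) + 1))
  rOut := 1 / ((k : ℝ) + 1)
  rIn_pos := by positivity
  rIn_lt_rOut := by
    apply one_div_lt_one_div_of_lt <;> nlinarith [(k.cast_nonneg : (0:ℝ) ≤ k)]

lemma bumpSeq_tendsto : Tendsto (fun k => (bumpSeq n k).rOut) atTop (𝓝 0) := 
  tendsto_one_div_add_atTop_nhds_zero_nat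

lemma mollify_tendsto {q : ℝ} (hq1 : 1 ≤ q) {g : 𝔼 → F} (hgm : Measurable g)
    (hg : MemLp g (ENNReal.ofReal q) volume) :
    Tendsto (fun k => eLpNorm (fun x => ((bumpSeq n k).normed volume ⋆[ContinuousLinearMap.lsmul ℝ ℝ, volume] g) x - g x)
      (ENNReal.ofReal q) volume) atTop (𝓝 0) := by
  have hq1' : 1 ≤ ENNReal.ofReal q := by simpa using hq1
  have ht := tendsto_translate hq1' ENNReal.ofReal_ne_top hg
  rw [ENNReal.tendsto_nhds_zero] at ht ⊢
  intro δ hδ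
  obtain ⟨ε, hε, hb⟩ := Metric.eventually_nhds_iff.1 (ht δ hδ)
  filter_upwards [bumpSeq_tendsto.eventually_lt_const hε] with k hk
  apply mollify_bound hq1 hgm (hg.locallyIntegrable hq1')
  intro y hy
  apply hb
  rw [dist_zero_right]; linarith

lemma gradient_mollify {u : 𝔼 → ℝ} {G : 𝔼 → 𝔼} (hu : LocallyIntegrable u volume)
    {z : 𝔼} {R : ℝ} 
    (hwk : ∀ φ : 𝔼 → ℝ, ContDiff ℝ 1 φ → HasCompactSupport φ → tsupport φ ⊆ ball z R →
      ∫ x, u x • gradient φ x = -∫ x, φ x • G x) (φ : ContDiffBump (0 : 𝔼)) {x : 𝔼} 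
    (hx : dist x z + φ.rOut < R) :
    gradient (φ.normed volume ⋆[ContinuousLinearMap.lsmul ℝ ℝ, volume] u) x =
      (φ.normed volume ⋆[ContinuousLinearMap.lsmul ℝ ℝ, volume] G) x := by
  set ρ := φ.normed volume with hρ
  have hρs : HasCompactSupport ρ := φ.hasCompactSupport_normed
  have hρc : ContDiff ℝ 1 ρ := φ.contDiff_normed
  have h1 := hρs.hasFDerivAt_convolution_left (ContinuousLinearMap.lsmul ℝ ℝ) hρc hu x
  have hρd : Differentiable ℝ ρ := hρc.differentiable one_ne_zero
  rw [gradient, h1.fderiv]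
  -- test function
  set ψ : 𝔼 → ℝ := fun y => ρ (x - y) with hψ
  have hψc : ContDiff ℝ 1 ψ := hρc.comp (contDiff_const.sub contDiff_id)
  have hts : tsupport ψ ⊆ closedBall x φ.rOut := by
    apply closure_minimal _ isClosed_closedBall
    intro y hy
    have : x - y ∈ Function.support ρ := hy
    rw [hρ, φ.support_normed_eq, mem_ball_zero_iff] at this
    rw [mem_closedBall, dist_comm, dist_eq_norm]; exact this.le
  have hψs : HasCompactSupport ψ := 
    (isCompact_closedBall x φ.rOut).of_isClosed_subset (isClosed_tsupport _) hts
  have hw := hwk ψ hψc hψs (hts.trans (closedBall_subset_ball' (by linarith)))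
  have hgr : ∀ y, gradient ψ y = - gradient ρ (x - y) := by
    intro y
    have hd : HasFDerivAt ψ (-(fderiv ℝ ρ (x - y))) y := by
      have h := ((hρd (x - y)).hasFDerivAt).comp y ((hasFDerivAt_id y).const_sub x)
      exact h.congr_fderiv (by ext v; simp)
    rw [gradient, hd.fderiv, gradient, map_neg]
  have e2 : (ρ ⋆[ContinuousLinearMap.lsmul ℝ ℝ, volume] G) x = ∫ y, ψ y • G y := by
    rw [convolution_eq_swap]; rfl
  rw [e2]
  have hw' : ∫ y, ψ y • G y = - ∫ y, u y • gradient ψ y := by rw [hw, neg_neg]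
  rw [hw']
  have hfc : Continuous (fderiv ℝ ρ) := hρc.continuous_fderiv one_ne_zero
  have hI1 : Integrable (fun y => (ContinuousLinearMap.precompL 𝔼 (ContinuousLinearMap.lsmul ℝ ℝ))
      (fderiv ℝ ρ (x - y)) (u y)) volume := by
    have := (hρs.fderiv ℝ).convolutionExists_left 
      (ContinuousLinearMap.precompL 𝔼 (ContinuousLinearMap.lsmul ℝ ℝ)) hfc hu x
    exact this.integrable_swap
  have hgc : Continuous (gradient ψ) := 
    (InnerProductSpace.toDual ℝ 𝔼).symm.continuous.comp (hψc.continuous_fderiv one_ne_zero)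
  have hgs : HasCompactSupport (gradient ψ) := (hψs.fderiv ℝ).comp_left (map_zero _)
  have hI2 : Integrable (fun y => u y • gradient ψ y) volume := 
    hu.integrable_smul_right_of_hasCompactSupport hgc hgs
  rw [LinearIsometryEquiv.symm_apply_eq]
  ext v
  rw [InnerProductSpace.toDual_apply_apply, inner_neg_left, real_inner_comm, ← integral_inner hI2, 
    convolution_eq_swap, ContinuousLinearMap.integral_apply hI1, ← integral_neg]
  congr 1; ext1 y
  rw [hgr, smul_neg, inner_neg_right, neg_neg, inner_smul_right, real_inner_comm]
  simp [gradient, ContinuousLinearMap.precompL_apply, InnerProductSpace.toDual_symm_apply, mul_comm]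

lemma sobolev_approx {q : ℝ} (hq1 : 1 ≤ q) {u : 𝔼 → ℝ} {G : 𝔼 → 𝔼} (hum : Measurable u)
    (hGm : Measurable G) (hu : MemLp u (ENNReal.ofReal q) volume) 
    (hG : MemLp G (ENNReal.ofReal q) volume) 
    {z : 𝔼} {R R' : ℝ} (hR : R' < R)
    (hwk : ∀ φ : 𝔼 → ℝ, ContDiff ℝ 1 φ → HasCompactSupport φ → tsupport φ ⊆ ball z R →
      ∫ x, u x • gradient φ x = -∫ x, φ x • G x) :
    ∃ v : ℕ → 𝔼 → ℝ, (∀ k, ContDiff ℝ 1 (v k)) ∧ 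
      Tendsto (fun k => eLpNorm (fun x => v k x - u x) (ENNReal.ofReal q) volume) atTop (𝓝 0) ∧
      Tendsto (fun k => eLpNorm (fun x => gradient (v k) x - G x) (ENNReal.ofReal q) 
        (volume.restrict (ball z R'))) atTop (𝓝 0) := by
  have hq1' : 1 ≤ ENNReal.ofReal q := by simpa using hq1
  have hul := hu.locallyIntegrable hq1'
  refine ⟨fun k => (bumpSeq n k).normed volume ⋆[ContinuousLinearMap.lsmul ℝ ℝ, volume] u, 
    fun k => ?_, mollify_tendsto hq1 hum hu, ?_⟩
  · exact (bumpSeq n k).hasCompactSupport_normed.contDiff_convolution_left (n := 1) _ 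
      (bumpSeq n k).contDiff_normed hul
  · refine tendsto_of_tendsto_of_tendsto_of_le_of_le' tendsto_const_nhds (mollify_tendsto hq1 hGm hG) 
      (Eventually.of_forall fun _ => zero_le) ?_
    filter_upwards [(bumpSeq_tendsto (n := n)).eventually_lt_const (sub_pos.2 hR)] with k hk
    refine le_trans (le_of_eq ?_) (eLpNorm_mono_measure _ (Measure.restrict_le_self (s := ball z R')))
    apply eLpNorm_congr_ae
    filter_upwards [ae_restrict_mem measurableSet_ball] with x hx
    rw [gradient_mollify hul hwk]
    rw [mem_ball] at hx; linarith

end PartM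

section PartC
open Filter Topology

variable {n : ℕ}
local notation "𝔼" => EuclideanSpace ℝ (Fin n)

lemma enorm_gradient (v : 𝔼 → ℝ) (x : 𝔼) : ‖gradient v x‖ₑ = ‖fderiv ℝ v x‖ₑ := by
  rw [gradient, LinearIsometryEquiv.enorm_map]

lemma continuous_gradient {v : 𝔼 → ℝ} (hv : ContDiff ℝ 1 v) : Continuous (gradient v) := 
  (InnerProductSpace.toDual ℝ 𝔼).symm.continuous.comp (hv.continuous_fderiv one_ne_zero)

lemma diff_C1 {q : ℝ} (hq1 : 1 ≤ q) {v : 𝔼 → ℝ} (hv : ContDiff ℝ 1 v) (z h : 𝔼) (R1 : ℝ) :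
    ∫⁻ x in ball z R1, ‖v (x + h) - v x‖ₑ ^ q ≤ 
      ‖h‖ₑ ^ q * ∫⁻ x in ball z (R1 + ‖h‖), ‖gradient v x‖ₑ ^ q := by
  have hq0 : 0 < q := by linarith
  set ν : Measure ℝ := volume.restrict (Set.Ioc 0 1) with hν
  have hprob : IsProbabilityMeasure ν := ⟨by simp [hν]⟩
  have hgc := (continuous_gradient hv).measurable
  have hfc := hv.continuous_fderiv one_ne_zero
  have hpt : ∀ x, ‖v (x + h) - v x‖ₑ ^ q ≤ ‖h‖ₑ ^ q * ∫⁻ t, ‖gradient v (x + t • h)‖ₑ ^ q ∂ν := by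
    intro x
    have hd : ∀ t : ℝ, HasDerivAt (fun t : ℝ => v (x + t • h)) (fderiv ℝ v (x + t • h) h) t := by
      intro t
      have h1 : HasDerivAt (fun t : ℝ => x + t • h) h t := by
        simpa using ((hasDerivAt_id t).smul_const h).const_add x
      exact ((hv.differentiable one_ne_zero (x + t • h)).hasFDerivAt).comp_hasDerivAt t h1
    have hc : Continuous (fun t : ℝ => fderiv ℝ v (x + t • h) h) := by fun_prop
    have h2 := intervalIntegral.integral_eq_sub_of_hasDerivAt (a := 0) (b := 1) (fun t _ => hd t) 
      (hc.intervalIntegrable _ _)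
    simp only [one_smul, zero_smul, add_zero] at h2
    rw [← h2, intervalIntegral.integral_of_le zero_le_one]
    have h3 : ‖∫ t in Set.Ioc (0:ℝ) 1, fderiv ℝ v (x + t • h) h‖ₑ ≤ 
        ‖h‖ₑ * ∫⁻ t, ‖gradient v (x + t • h)‖ₑ ∂ν := by
      refine (enorm_integral_le_lintegral_enorm _).trans ?_
      rw [← lintegral_const_mul _ (by fun_prop)]
      apply lintegral_mono
      intro t
      simp only
      rw [enorm_gradient, mul_comm]
      exact (fderiv ℝ v (x + t • h)).le_opENorm h
    calc _ ≤ (‖h‖ₑ * ∫⁻ t, ‖gradient v (x + t • h)‖ₑ ∂ν) ^ q := ENNReal.rpow_le_rpow h3 hq0.le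
      _ = ‖h‖ₑ ^ q * (∫⁻ t, ‖gradient v (x + t • h)‖ₑ ∂ν) ^ q := ENNReal.mul_rpow_of_nonneg _ _ hq0.le
      _ ≤ _ := by
        gcongr
        exact jensen_lintegral ν (Measurable.aemeasurable (by fun_prop)) hq1
  calc _ ≤ ∫⁻ x in ball z R1, ‖h‖ₑ ^ q * ∫⁻ t, ‖gradient v (x + t • h)‖ₑ ^ q ∂ν := lintegral_mono hpt
    _ = ‖h‖ₑ ^ q * ∫⁻ x in ball z R1, ∫⁻ t, ‖gradient v (x + t • h)‖ₑ ^ q ∂ν := by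
      rw [lintegral_const_mul']
      exact ENNReal.rpow_ne_top_of_nonneg hq0.le (by simp)
    _ = ‖h‖ₑ ^ q * ∫⁻ t, ∫⁻ x in ball z R1, ‖gradient v (x + t • h)‖ₑ ^ q ∂volume ∂ν := by
      rw [lintegral_lintegral_swap]
      apply Measurable.aemeasurable
      fun_prop
    _ ≤ ‖h‖ₑ ^ q * ∫⁻ t, (∫⁻ x in ball z (R1 + ‖h‖), ‖gradient v x‖ₑ ^ q) ∂ν := by
      gcongr ‖h‖ₑ ^ q * ?_
      apply lintegral_mono_ae
      filter_upwards [ae_restrict_mem measurableSet_Ioc] with t ht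
      rw [← lintegral_indicator measurableSet_ball, ← lintegral_indicator measurableSet_ball]
      rw [← lintegral_add_right_eq_self (fun x => (ball z (R1 + ‖h‖)).indicator _ x) (t • h)]
      apply lintegral_mono
      intro x
      by_cases hx : x ∈ ball z R1
      · have : x + t • h ∈ ball z (R1 + ‖h‖) := by
          rw [mem_ball] at hx ⊢
          calc dist (x + t • h) z ≤ dist (x + t • h) x + dist x z := dist_triangle _ _ _
            _ < _ := by
              rw [dist_eq_norm, add_sub_cancel_left, norm_smul, Real.norm_eq_abs, abs_of_pos ht.1]
              nlinarith [ht.2, norm_nonneg h]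
        simp [Set.indicator_of_mem hx, Set.indicator_of_mem this]
      · simp [Set.indicator_of_notMem hx]
    _ = _ := by simp

lemma diff_C1' {q : ℝ} (hq1 : 1 ≤ q) {v : 𝔼 → ℝ} (hv : ContDiff ℝ 1 v) (z h : 𝔼) (R1 : ℝ) :
    eLpNorm (fun x => v (x + h) - v x) (ENNReal.ofReal q) (volume.restrict (ball z R1)) ≤ 
      ‖h‖ₑ * eLpNorm (gradient v) (ENNReal.ofReal q) (volume.restrict (ball z (R1 + ‖h‖))) := by
  have hq0 : 0 < q := by linarith
  have hqn : ENNReal.ofReal q ≠ 0 := by simpa using hq0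
  rw [eLpNorm_eq_lintegral_rpow_enorm_toReal hqn ENNReal.ofReal_ne_top, 
    eLpNorm_eq_lintegral_rpow_enorm_toReal hqn ENNReal.ofReal_ne_top, 
    ENNReal.toReal_ofReal hq0.le, one_div, ENNReal.rpow_inv_le_iff hq0, 
    ENNReal.mul_rpow_of_nonneg _ _ hq0.le, ENNReal.rpow_inv_rpow hq0.ne']
  exact diff_C1 hq1 hv z h R1

lemma eLpNorm_shift {F : Type*} [NormedAddCommGroup F] {q : ℝ≥0∞} {w : 𝔼 → F} 
    (hw : AEStronglyMeasurable w volume) (h : 𝔼) :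
    eLpNorm (fun x => w (x + h)) q volume = eLpNorm w q volume := 
  eLpNorm_comp_measurePreserving hw (measurePreserving_add_right volume h)

lemma eLpNorm_diff_le {F : Type*} [NormedAddCommGroup F] {q : ℝ≥0∞} (hq : 1 ≤ q) {w : 𝔼 → F} 
    (hw : AEStronglyMeasurable w volume) (h : 𝔼) :
    eLpNorm (fun x => w (x + h) - w x) q volume ≤ 2 * eLpNorm w q volume := by
  have hw' : AEStronglyMeasurable (fun x => w (x + h)) volume := 
    hw.comp_measurePreserving (measurePreserving_add_right volume h)
  refine (eLpNorm_sub_le hw' hw hq).trans ?_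
  rw [eLpNorm_shift hw, two_mul]

lemma diff_sobolev {q : ℝ} (hq1 : 1 ≤ q) {u : 𝔼 → ℝ} {G : 𝔼 → 𝔼} (hum : Measurable u)
    (hGm : Measurable G) (hu : MemLp u (ENNReal.ofReal q) volume) 
    (hG : MemLp G (ENNReal.ofReal q) volume) 
    {z : 𝔼} {R R1 : ℝ} {h : 𝔼} (hR : R1 + ‖h‖ < R)
    (hwk : ∀ φ : 𝔼 → ℝ, ContDiff ℝ 1 φ → HasCompactSupport φ → tsupport φ ⊆ ball z R →
      ∫ x, u x • gradient φ x = -∫ x, φ x • G x) :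
    eLpNorm (fun x => u (x + h) - u x) (ENNReal.ofReal q) (volume.restrict (ball z R1)) ≤ 
      ‖h‖ₑ * eLpNorm G (ENNReal.ofReal q) volume := by
  have hq1' : 1 ≤ ENNReal.ofReal q := by simpa using hq1
  obtain ⟨v, hv, hv1, hv2⟩ := sobolev_approx hq1 hum hGm hu hG hR hwk
  set Q := ENNReal.ofReal q
  set μ' := (volume : Measure 𝔼).restrict (ball z (R1 + ‖h‖))
  have key : ∀ k, eLpNorm (fun x => u (x + h) - u x) Q (volume.restrict (ball z R1)) ≤ 
      2 * eLpNorm (fun x => v k x - u x) Q volume + 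
      ‖h‖ₑ * (eLpNorm (fun x => gradient (v k) x - G x) Q μ' + eLpNorm G Q volume) := by
    intro k
    have hvm : Measurable (v k) := (hv k).continuous.measurable
    have hgm : Measurable (gradient (v k)) := (continuous_gradient (hv k)).measurable
    have e1 : (fun x => u (x + h) - u x) = (fun x => v k (x + h) - v k x) - 
        (fun x => (fun y => v k y - u y) (x + h) - (fun y => v k y - u y) x) := by
      ext x; simp; ring
    rw [e1, add_comm]
    refine (eLpNorm_sub_le (Measurable.aestronglyMeasurable (by fun_prop)) 
      (Measurable.aestronglyMeasurable (by fun_prop)) hq1').trans ?_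
    gcongr
    · refine (diff_C1' hq1 (hv k) z h R1).trans ?_
      gcongr
      have e2 : gradient (v k) = (fun x => gradient (v k) x - G x) + G := by ext x; simp
      calc _ = eLpNorm ((fun x => gradient (v k) x - G x) + G) Q μ' := by rw [← e2]
        _ ≤ eLpNorm (fun x => gradient (v k) x - G x) Q μ' + eLpNorm G Q μ' := 
          eLpNorm_add_le (Measurable.aestronglyMeasurable (by fun_prop)) 
            (Measurable.aestronglyMeasurable (by fun_prop)) hq1'
        _ ≤ _ := by gcongr; exact Measure.restrict_le_self
    · refine (eLpNorm_mono_measure _ Measure.restrict_le_self).trans ?_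
      exact eLpNorm_diff_le (w := fun y => v k y - u y) hq1' (Measurable.aestronglyMeasurable (by fun_prop)) h
  have hlim : Tendsto (fun k => 2 * eLpNorm (fun x => v k x - u x) Q volume + 
      ‖h‖ₑ * (eLpNorm (fun x => gradient (v k) x - G x) Q μ' + eLpNorm G Q volume)) atTop 
      (𝓝 (2 * 0 + ‖h‖ₑ * (0 + eLpNorm G Q volume))) := by
    refine (ENNReal.Tendsto.const_mul hv1 (by simp)).add ?_
    exact ENNReal.Tendsto.const_mul (hv2.add tendsto_const_nhds) (by simp)
  have := ge_of_tendsto' hlim key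
  simpa using this

end PartC

section PartE
open Filter Topology

lemma lint_mul_le {X E F : Type*} [MeasurableSpace X] [NormedAddCommGroup E] [NormedAddCommGroup F] 
    {μ : Measure X} {p q : ℝ} (hpq : p.HolderConjugate q) {A : X → E} {B : X → F} 
    (hA : AEStronglyMeasurable A μ) (hB : AEStronglyMeasurable B μ) : 
    ∫⁻ x, ‖A x‖ₑ * ‖B x‖ₑ ∂μ ≤ eLpNorm A (ENNReal.ofReal p) μ * eLpNorm B (ENNReal.ofReal q) μ := by
  have hp := hpq.pos
  have hq := hpq.symm.pos
  rw [eLpNorm_eq_lintegral_rpow_enorm_toReal (by simpa using hp) ENNReal.ofReal_ne_top, 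
    eLpNorm_eq_lintegral_rpow_enorm_toReal (by simpa using hq) ENNReal.ofReal_ne_top, 
    ENNReal.toReal_ofReal hp.le, ENNReal.toReal_ofReal hq.le]
  exact ENNReal.lintegral_mul_le_Lp_mul_Lq μ hpq hA.enorm hB.enorm

lemma int_norm_mul {X E F : Type*} [MeasurableSpace X] [NormedAddCommGroup E] [NormedAddCommGroup F] 
    {μ : Measure X} {p q : ℝ} (hpq : p.HolderConjugate q) {A : X → E} {B : X → F} 
    (hA : MemLp A (ENNReal.ofReal p) μ) (hB : MemLp B (ENNReal.ofReal q) μ) : 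
    Integrable (fun x => ‖A x‖ * ‖B x‖) μ := by
  refine ⟨hA.1.norm.mul hB.1.norm, ?_⟩
  rw [HasFiniteIntegral]
  simp only [enorm_mul, enorm_norm]
  exact (lint_mul_le hpq hA.1 hB.1).trans_lt (ENNReal.mul_lt_top hA.2 hB.2)

lemma int_norm_mul_le {X E F : Type*} [MeasurableSpace X] [NormedAddCommGroup E] [NormedAddCommGroup F] 
    {μ : Measure X} {p q : ℝ} (hpq : p.HolderConjugate q) {A : X → E} {B : X → F} 
    (hA : MemLp A (ENNReal.ofReal p) μ) (hB : MemLp B (ENNReal.ofReal q) μ) : 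
    ∫ x, ‖A x‖ * ‖B x‖ ∂μ ≤ (eLpNorm A (ENNReal.ofReal p) μ).toReal * 
      (eLpNorm B (ENNReal.ofReal q) μ).toReal := by
  rw [integral_eq_lintegral_of_nonneg_ae (Eventually.of_forall fun x => by positivity) 
    (int_norm_mul hpq hA hB).1, ← ENNReal.toReal_mul]
  apply ENNReal.toReal_mono (ENNReal.mul_lt_top hA.2 hB.2).ne
  refine le_trans (le_of_eq ?_) (lint_mul_le hpq hA.1 hB.1)
  congr 1; ext x
  rw [ENNReal.ofReal_mul (norm_nonneg _), ofReal_norm_eq_enorm, ofReal_norm_eq_enorm]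

lemma int_inner {X F : Type*} [MeasurableSpace X] [NormedAddCommGroup F] [InnerProductSpace ℝ F]
    {μ : Measure X} {p q : ℝ} (hpq : p.HolderConjugate q) {A : X → F} {B : X → F} 
    (hA : MemLp A (ENNReal.ofReal p) μ) (hB : MemLp B (ENNReal.ofReal q) μ) : 
    Integrable (fun x => ⟪A x, B x⟫) μ := 
  (int_norm_mul hpq hA hB).mono' (hA.1.inner hB.1) 
    (Eventually.of_forall fun x => norm_inner_le_norm _ _)

lemma tendsto_int_inner {X F : Type*} [MeasurableSpace X] [NormedAddCommGroup F] [InnerProductSpace ℝ F]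
    {μ : Measure X} {p q : ℝ} (hpq : p.HolderConjugate q) {A : X → F} {B : X → F} {Bk : ℕ → X → F} 
    (hA : MemLp A (ENNReal.ofReal p) μ) (hB : MemLp B (ENNReal.ofReal q) μ)
    (hBk : ∀ k, MemLp (Bk k) (ENNReal.ofReal q) μ) 
    (hl : Tendsto (fun k => eLpNorm (fun x => Bk k x - B x) (ENNReal.ofReal q) μ) atTop (𝓝 0)) :
    Tendsto (fun k => ∫ x, ⟪A x, Bk k x⟫ ∂μ) atTop (𝓝 (∫ x, ⟪A x, B x⟫ ∂μ)) := by
  apply tendsto_integral_of_L1 _ (int_inner hpq hA hB).1 (Eventually.of_forall fun k => int_inner hpq hA (hBk k))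
  have h2 : Tendsto (fun k => eLpNorm A (ENNReal.ofReal p) μ * eLpNorm (fun x => Bk k x - B x) (ENNReal.ofReal q) μ)
      atTop (𝓝 0) := by
    simpa using ENNReal.Tendsto.const_mul hl (Or.inr hA.2.ne)
  refine tendsto_of_tendsto_of_tendsto_of_le_of_le tendsto_const_nhds h2 (fun _ => zero_le) fun k => ?_
  refine le_trans ?_ (lint_mul_le hpq hA.1 ((hBk k).1.sub hB.1))
  apply lintegral_mono
  intro x
  simp only [← inner_sub_right, Pi.sub_apply]
  rw [← ofReal_norm_eq_enorm, ← ofReal_norm_eq_enorm, ← ofReal_norm_eq_enorm, ← ENNReal.ofReal_mul (norm_nonneg _)]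
  exact ENNReal.ofReal_le_ofReal (norm_inner_le_norm _ _)

lemma int_rpow_eq {X F : Type*} [MeasurableSpace X] [NormedAddCommGroup F] {μ : Measure X} {q : ℝ} (hq : 0 < q)
    {B : X → F} (hB : MemLp B (ENNReal.ofReal q) μ) :
    Integrable (fun x => ‖B x‖ ^ q) μ ∧ 
    ∫ x, ‖B x‖ ^ q ∂μ = (eLpNorm B (ENNReal.ofReal q) μ).toReal ^ q := by
  have hI := hB.integrable_norm_rpow (by simpa using hq) ENNReal.ofReal_ne_top
  rw [ENNReal.toReal_ofReal hq.le] at hI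
  refine ⟨hI, ?_⟩
  rw [hB.eLpNorm_eq_integral_rpow_norm (by simpa using hq) ENNReal.ofReal_ne_top, 
    ENNReal.toReal_ofReal hq.le]
  have : 0 ≤ ∫ x, ‖B x‖ ^ q ∂μ := integral_nonneg fun x => by positivity
  rw [ENNReal.toReal_ofReal (by positivity), Real.rpow_inv_rpow this hq.ne']

lemma energy_est {X F : Type*} [MeasurableSpace X] [NormedAddCommGroup F] [InnerProductSpace ℝ F]
    {μ : Measure X} {p q L : ℝ} (hpq : p.HolderConjugate q) (hp2 : 2 ≤ p) (hq1 : 1 < q) (hL : 0 ≤ L) 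
    {S W dV N : X → F} {du df η : X → ℝ} 
    (hS : MemLp S (ENNReal.ofReal p) μ) (hW : MemLp W (ENNReal.ofReal q) μ)
    (hdV : MemLp dV (ENNReal.ofReal 2) μ) (hdu : MemLp du (ENNReal.ofReal q) μ) 
    (hdf : MemLp df (ENNReal.ofReal p) μ) (hη : AEStronglyMeasurable η μ) (hN : AEStronglyMeasurable N μ)
    (hη0 : ∀ x, 0 ≤ η x) (hη1 : ∀ x, η x ≤ 1) (hNL : ∀ x, ‖N x‖ ≤ L)
    (hmono : ∀ x, (q - 1) * ‖dV x‖ ^ 2 ≤ ⟪S x, W x⟫) 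
    (hhol : ∀ x, ‖S x‖ ^ p ≤ 3 ^ p * ‖dV x‖ ^ 2)
    (hid : ∫ x, ⟪S x, (η x ^ 2) • W x + (2 * η x * du x) • N x⟫ ∂μ = ∫ x, df x * (η x ^ 2 * du x) ∂μ) :
    (q - 1) / 2 * ∫ x, η x ^ 2 * ‖dV x‖ ^ 2 ∂μ ≤ 
      (eLpNorm df (ENNReal.ofReal p) μ).toReal * (eLpNorm du (ENNReal.ofReal q) μ).toReal + 
      (2 * L / (((q - 1) / 2) ^ (1 / p) / 3)) ^ q * (eLpNorm du (ENNReal.ofReal q) μ).toReal ^ q := by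
  have hp := hpq.pos
  have hq := hpq.symm.pos
  set δ : ℝ := ((q - 1) / 2) ^ (1 / p) / 3 with hδ
  have hδ0 : 0 < δ := by
    have : 0 < (q - 1) / 2 := by linarith
    positivity
  have hδp : δ ^ p * 3 ^ p = (q - 1) / 2 := by
    rw [← Real.mul_rpow hδ0.le (by norm_num), hδ, div_mul_cancel₀ _ (by norm_num), one_div, 
      Real.rpow_inv_rpow (by linarith) hp.ne']
  have hη2 : ∀ x, η x ^ 2 ≤ 1 := fun x => pow_le_one₀ (hη0 x) (hη1 x)
  -- integrability
  have hdVI := (int_rpow_eq (by norm_num) hdV).1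
  have hV2 : Integrable (fun x => η x ^ 2 * ‖dV x‖ ^ 2) μ := by
    have : Integrable (fun x => ‖dV x‖ ^ 2) μ := by simpa using hdVI
    refine this.mono' ((hη.pow 2).mul (hdV.1.norm.pow 2)) (Eventually.of_forall fun x => ?_)
    rw [Real.norm_of_nonneg (by positivity)]
    exact mul_le_of_le_one_left (by positivity) (hη2 x)
  have hηW : MemLp (fun x => (η x ^ 2) • W x) (ENNReal.ofReal q) μ := by
    refine hW.mono ((hη.pow 2).smul hW.1) (Eventually.of_forall fun x => ?_)
    rw [norm_smul, Real.norm_of_nonneg (by positivity)]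
    exact mul_le_of_le_one_left (by positivity) (hη2 x)
  have hduN : MemLp (fun x => (2 * η x * du x) • N x) (ENNReal.ofReal q) μ := by
    refine (hdu.const_mul (2 * L)).mono (((hη.const_mul 2).mul hdu.1).smul hN) (Eventually.of_forall fun x => ?_)
    rw [norm_smul, norm_mul, norm_mul, norm_mul, Real.norm_of_nonneg (hη0 x), 
      Real.norm_of_nonneg (show (0:ℝ) ≤ 2 by norm_num), Real.norm_of_nonneg (show 0 ≤ 2 * L by positivity)]
    calc 2 * η x * ‖du x‖ * ‖N x‖ ≤ 2 * 1 * ‖du x‖ * L := by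
          gcongr
          · exact hη1 x
          · exact hNL x
      _ = _ := by ring
  have hI1 := int_inner hpq hS (hηW.add hduN)
  have hduI := int_rpow_eq hq hdu
  have hfu := int_norm_mul hpq hdf hdu
  have hfuI : Integrable (fun x => df x * (η x ^ 2 * du x)) μ := by
    refine hfu.mono' (hdf.1.mul ((hη.pow 2).mul hdu.1)) (Eventually.of_forall fun x => ?_)
    rw [norm_mul, norm_mul, Real.norm_of_nonneg (show 0 ≤ η x ^ 2 by positivity)]
    gcongr
    exact mul_le_of_le_one_left (by positivity) (hη2 x)
  -- pointwise bound
  have hpt : ∀ x, (q - 1) / 2 * (η x ^ 2 * ‖dV x‖ ^ 2) ≤ 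
      ⟪S x, (η x ^ 2) • W x + (2 * η x * du x) • N x⟫ + (2 * L / δ) ^ q * ‖du x‖ ^ q := by
    intro x
    rw [inner_add_right, inner_smul_right]
    have h1 : -⟪S x, (2 * η x * du x) • N x⟫ ≤ (η x * ‖S x‖ * δ) * (2 * L / δ * ‖du x‖) := by
      refine (neg_le_abs _).trans ((abs_real_inner_le_norm _ _).trans ?_)
      rw [norm_smul, norm_mul, norm_mul, Real.norm_of_nonneg (hη0 x), 
        Real.norm_of_nonneg (show (0:ℝ) ≤ 2 by norm_num)]
      have e : (η x * ‖S x‖ * δ) * (2 * L / δ * ‖du x‖) = ‖S x‖ * (2 * η x * ‖du x‖ * L) := by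
        field_simp
      rw [e]
      have := hη0 x
      gcongr
      exact hNL x
    have h2 := Real.young_inequality_of_nonneg (a := η x * ‖S x‖ * δ) (b := 2 * L / δ * ‖du x‖) 
      (by have := hη0 x; positivity) (by positivity) hpq
    have h3 : (η x * ‖S x‖ * δ) ^ p / p ≤ (q - 1) / 2 * (η x ^ 2 * ‖dV x‖ ^ 2) := by
      have hηp : η x ^ p ≤ η x ^ 2 := by
        rcases (hη0 x).eq_or_lt with h0 | h0
        · rw [← h0, Real.zero_rpow hp.ne']; simp
        · rw [← Real.rpow_two]
          exact Real.rpow_le_rpow_of_exponent_ge h0 (hη1 x) hp2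
      have h4 : (η x * ‖S x‖ * δ) ^ p ≤ (q - 1) / 2 * (η x ^ 2 * ‖dV x‖ ^ 2) := by
        rw [Real.mul_rpow (mul_nonneg (hη0 x) (norm_nonneg _)) hδ0.le, Real.mul_rpow (hη0 x) (norm_nonneg _)]
        calc η x ^ p * ‖S x‖ ^ p * δ ^ p ≤ η x ^ 2 * (3 ^ p * ‖dV x‖ ^ 2) * δ ^ p := by
              gcongr
              exact hhol x
          _ = (δ ^ p * 3 ^ p) * (η x ^ 2 * ‖dV x‖ ^ 2) := by ring
          _ = _ := by rw [hδp]
      refine (div_le_self ?_ (by linarith)).trans h4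
      have := hη0 x
      positivity
    have h5 : (2 * L / δ * ‖du x‖) ^ q / q ≤ (2 * L / δ) ^ q * ‖du x‖ ^ q := by
      rw [← Real.mul_rpow (by positivity) (norm_nonneg _)]
      exact div_le_self (by positivity) hq1.le
    have h6 : η x ^ 2 * ((q - 1) * ‖dV x‖ ^ 2) ≤ η x ^ 2 * ⟪S x, W x⟫ := by
      gcongr; exact hmono x
    linarith
  rw [← integral_const_mul]
  calc ∫ x, (q - 1) / 2 * (η x ^ 2 * ‖dV x‖ ^ 2) ∂μ ≤ 
      ∫ x, (⟪S x, (η x ^ 2) • W x + (2 * η x * du x) • N x⟫ + (2 * L / δ) ^ q * ‖du x‖ ^ q) ∂μ := 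
        integral_mono (hV2.const_mul _) (hI1.add (hduI.1.const_mul _)) hpt
    _ = ∫ x, df x * (η x ^ 2 * du x) ∂μ + (2 * L / δ) ^ q * (eLpNorm du (ENNReal.ofReal q) μ).toReal ^ q := by
        rw [← hid, ← hduI.2, ← integral_const_mul]
        exact integral_add hI1 (hduI.1.const_mul _)
    _ ≤ _ := by
        gcongr
        refine le_trans ?_ (int_norm_mul_le hpq hdf hdu)
        apply integral_mono hfuI hfu
        intro x
        simp only
        refine (le_abs_self _).trans ?_
        rw [← Real.norm_eq_abs, norm_mul, norm_mul, Real.norm_of_nonneg (show 0 ≤ η x ^ 2 by positivity)]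
        gcongr
        exact mul_le_of_le_one_left (by positivity) (hη2 x)

end PartE

section PartF
open Filter Topology

variable {n : ℕ}
local notation "𝔼" => EuclideanSpace ℝ (Fin n)

lemma measurable_Hmap (a : ℝ) : Measurable (Hmap n a) := by
  unfold Hmap
  fun_prop

lemma memLp_Hmap {q a b : ℝ} (ha : 0 < a) (hb : b = q / a) {G : 𝔼 → 𝔼} (hGm : Measurable G) {μ : Measure 𝔼}
    (hG : MemLp G (ENNReal.ofReal q) μ) : MemLp (fun x => Hmap n a (G x)) (ENNReal.ofReal b) μ := by
  have h1 := hG.norm_rpow_div (ENNReal.ofReal a)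
  rw [ENNReal.toReal_ofReal ha.le, ← ENNReal.ofReal_div_of_pos ha, ← hb] at h1
  refine h1.mono ((measurable_Hmap a).comp hGm).aestronglyMeasurable (Eventually.of_forall fun x => ?_)
  rw [norm_Hmap ha, Real.norm_of_nonneg (by positivity)]
  apply Real.rpow_le_rpow (le_max_right _ _) _ ha.le
  apply max_le _ (norm_nonneg _)
  linarith

lemma memLp_shift {F : Type*} [NormedAddCommGroup F] {q : ℝ≥0∞} {w : 𝔼 → F} (hw : MemLp w q volume) (h : 𝔼) :
    MemLp (fun x => w (x + h)) q volume := 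
  hw.comp_measurePreserving (measurePreserving_add_right volume h)

lemma gradient_shift {ψ : 𝔼 → ℝ} (hψ : ContDiff ℝ 1 ψ) (h x : 𝔼) : 
    gradient (fun y => ψ (y + h)) x = gradient ψ (x + h) := by
  have : HasFDerivAt (fun y => ψ (y + h)) (fderiv ℝ ψ (x + h)) x := by
    have h1 := ((hψ.differentiable one_ne_zero (x + h)).hasFDerivAt).comp x ((hasFDerivAt_id x).add_const h)
    exact h1.congr_fderiv (by ext v; simp)
  rw [gradient, gradient, this.fderiv]

lemma memLp_gradient {ψ : 𝔼 → ℝ} (hψ : ContDiff ℝ 1 ψ) (hs : HasCompactSupport ψ) (q : ℝ≥0∞) :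
    MemLp (gradient ψ) q volume := 
  (continuous_gradient hψ).memLp_of_hasCompactSupport ((hs.fderiv ℝ).comp_left (map_zero _))

lemma diff_eq {p q : ℝ} (hpq : p.HolderConjugate q) {σ : 𝔼 → 𝔼} {f : 𝔼 → ℝ} 
    (hσ : MemLp σ (ENNReal.ofReal p) volume) (hf : MemLp f (ENNReal.ofReal p) volume) {z : 𝔼} {R R1 : ℝ}
    (hsol : ∀ φ : 𝔼 → ℝ, ContDiff ℝ 1 φ → HasCompactSupport φ → tsupport φ ⊆ ball z R →
      ∫ x, ⟪σ x, gradient φ x⟫ = ∫ x, f x * φ x) {h : 𝔼} (hR : R1 + ‖h‖ < R) 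
    {ψ : 𝔼 → ℝ} (hψ : ContDiff ℝ 1 ψ) (hts : tsupport ψ ⊆ closedBall z R1) :
    ∫ x, ⟪σ (x + h) - σ x, gradient ψ x⟫ = ∫ x, (f (x + h) - f x) * ψ x := by
  have hψs : HasCompactSupport ψ := 
    (isCompact_closedBall z R1).of_isClosed_subset (isClosed_tsupport _) hts
  have hsup : ∀ x, ψ x ≠ 0 → x ∈ closedBall z R1 := fun x hx => hts (subset_tsupport _ hx)
  set φ : 𝔼 → ℝ := fun y => ψ (y + (-h)) with hφ
  have hφc : ContDiff ℝ 1 φ := hψ.comp (contDiff_id.add contDiff_const)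
  have hφt : tsupport φ ⊆ closedBall z (R1 + ‖h‖) := by
    apply closure_minimal _ isClosed_closedBall
    intro y hy
    have := hsup _ hy
    rw [mem_closedBall] at this ⊢
    calc dist y z ≤ dist y (y + -h) + dist (y + -h) z := dist_triangle _ _ _
      _ ≤ ‖h‖ + R1 := by
        gcongr
        rw [dist_eq_norm]; simp
      _ = _ := add_comm _ _
  have hφs : HasCompactSupport φ := 
    (isCompact_closedBall z _).of_isClosed_subset (isClosed_tsupport _) hφt
  have h1 := hsol ψ hψ hψs (hts.trans (closedBall_subset_ball (by linarith [norm_nonneg h])))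
  have h2 := hsol φ hφc hφs (hφt.trans (closedBall_subset_ball hR))
  rw [← integral_add_right_eq_self _ h, ← integral_add_right_eq_self (fun x => f x * φ x) h] at h2
  simp only [hφ, gradient_shift hψ, add_neg_cancel_right] at h2
  have hgm := memLp_gradient hψ hψs (ENNReal.ofReal q)
  have hψm : MemLp ψ (ENNReal.ofReal q) volume := hψ.continuous.memLp_of_hasCompactSupport hψs
  simp_rw [inner_sub_left, sub_mul]
  rw [integral_sub (int_inner hpq (memLp_shift hσ h) hgm) (int_inner hpq hσ hgm), h2, h1, integral_sub]
  · have := int_inner hpq (memLp_shift hf h) hψm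
    simpa [mul_comm] using this
  · have := int_inner hpq hf hψm
    simpa [mul_comm] using this

lemma gradient_test {η v : 𝔼 → ℝ} (hη : ContDiff ℝ 1 η) (hv : ContDiff ℝ 1 v) (h x : 𝔼) :
    gradient (fun y => η y ^ 2 * (v (y + h) - v y)) x = (η x ^ 2) • (gradient v (x + h) - gradient v x) + 
      (2 * η x * (v (x + h) - v x)) • gradient η x := by
  have hηd := (hη.differentiable one_ne_zero x).hasFDerivAt
  have hvd := (hv.differentiable one_ne_zero x).hasFDerivAt
  have hvs : HasFDerivAt (fun y => v (y + h)) (fderiv ℝ v (x + h)) x := by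
    have h1 := ((hv.differentiable one_ne_zero (x + h)).hasFDerivAt).comp x ((hasFDerivAt_id x).add_const h)
    exact h1.congr_fderiv (by ext v; simp)
  have := (hηd.pow 2).mul (hvs.sub hvd)
  have h2 : HasFDerivAt (fun y => η y ^ 2 * (v (y + h) - v y)) ((η x ^ 2) • (fderiv ℝ v (x + h) - fderiv ℝ v x) + 
      (2 * η x * (v (x + h) - v x)) • fderiv ℝ η x) x := by
    refine this.congr_fderiv ?_
    ext w
    simp
    ring
  rw [gradient, h2.fderiv]
  simp [gradient]

lemma limit_eq {p q : ℝ} (hpq : p.HolderConjugate q) (hq1 : 1 < q) {σ G : 𝔼 → 𝔼} {u f : 𝔼 → ℝ} 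
    (hum : Measurable u) (hGm : Measurable G) (hu : MemLp u (ENNReal.ofReal q) volume) 
    (hG : MemLp G (ENNReal.ofReal q) volume) 
    (hσ : MemLp σ (ENNReal.ofReal p) volume) (hf : MemLp f (ENNReal.ofReal p) volume) {z : 𝔼} {R R1 R2 : ℝ}
    (hwk : ∀ φ : 𝔼 → ℝ, ContDiff ℝ 1 φ → HasCompactSupport φ → tsupport φ ⊆ ball z R →
      ∫ x, u x • gradient φ x = -∫ x, φ x • G x)
    (hsol : ∀ φ : 𝔼 → ℝ, ContDiff ℝ 1 φ → HasCompactSupport φ → tsupport φ ⊆ ball z R →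
      ∫ x, ⟪σ x, gradient φ x⟫ = ∫ x, f x * φ x) {h : 𝔼} (hR1 : R1 + ‖h‖ < R2) (hR2 : R2 < R) 
    {η : 𝔼 → ℝ} (hη : ContDiff ℝ 1 η) (hts : tsupport η ⊆ closedBall z R1) (hη0 : ∀ x, 0 ≤ η x) 
    (hη1 : ∀ x, η x ≤ 1) {L : ℝ} (hL : ∀ x, ‖gradient η x‖ ≤ L) :
    ∫ x, ⟪σ (x + h) - σ x, (η x ^ 2) • (G (x + h) - G x) + (2 * η x * (u (x + h) - u x)) • gradient η x⟫ = 
      ∫ x, (f (x + h) - f x) * (η x ^ 2 * (u (x + h) - u x)) := by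
  set Q := ENNReal.ofReal q with hQ
  have hq1' : 1 ≤ Q := by simpa [hQ] using hq1.le
  have hL0 : 0 ≤ L := (norm_nonneg _).trans (hL 0)
  have hη2 : ∀ x, η x ^ 2 ≤ 1 := fun x => pow_le_one₀ (hη0 x) (hη1 x)
  have hsup : ∀ x, η x ≠ 0 → x ∈ closedBall z R1 := fun x hx => hts (subset_tsupport _ hx)
  have hηs : HasCompactSupport η := 
    (isCompact_closedBall z R1).of_isClosed_subset (isClosed_tsupport _) hts
  have hηm : Measurable η := hη.continuous.measurable
  have hgm : Measurable (gradient η) := (continuous_gradient hη).measurable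
  obtain ⟨v, hv, hv1, hv2⟩ := sobolev_approx hq1.le hum hGm hu hG hR2 hwk
  have hvm : ∀ k, Measurable (v k) := fun k => (hv k).continuous.measurable
  have hvgm : ∀ k, Measurable (gradient (v k)) := fun k => (continuous_gradient (hv k)).measurable
  set ψ : ℕ → 𝔼 → ℝ := fun k y => η y ^ 2 * (v k (y + h) - v k y) with hψ
  have hψc : ∀ k, ContDiff ℝ 1 (ψ k) := fun k => 
    (hη.pow 2).mul (((hv k).comp (contDiff_id.add contDiff_const)).sub (hv k))
  have hψt : ∀ k, tsupport (ψ k) ⊆ closedBall z R1 := by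
    intro k
    apply closure_minimal _ isClosed_closedBall
    intro y hy
    apply hsup
    intro h0
    apply hy
    simp [hψ, h0]
  have hψs : ∀ k, HasCompactSupport (ψ k) := fun k => 
    (isCompact_closedBall z R1).of_isClosed_subset (isClosed_tsupport _) (hψt k)
  have hk : ∀ k, ∫ x, ⟪σ (x + h) - σ x, gradient (ψ k) x⟫ = ∫ x, (f (x + h) - f x) * ψ k x := 
    fun k => diff_eq hpq hσ hf hsol (hR1.trans hR2) (hψc k) (hψt k)
  set D : ℕ → 𝔼 → 𝔼 := fun k => (ball z R2).indicator (fun x => gradient (v k) x - G x) with hD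
  have hDm : ∀ k, Measurable (D k) := fun k => ((hvgm k).sub hGm).indicator measurableSet_ball
  have hDl : Tendsto (fun k => eLpNorm (D k) Q volume) atTop (𝓝 0) := by
    simpa only [hD, eLpNorm_indicator_eq_eLpNorm_restrict measurableSet_ball] using hv2
  have hdl : Tendsto (fun k => 2 * eLpNorm (D k) Q volume + 
      ENNReal.ofReal (2 * L) * (2 * eLpNorm (fun x => v k x - u x) Q volume)) atTop (𝓝 0) := by
    have a1 := ENNReal.Tendsto.const_mul (a := 2) hDl (by simp)
    have a2 := ENNReal.Tendsto.const_mul (a := ENNReal.ofReal (2 * L)) 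
      (ENNReal.Tendsto.const_mul (a := 2) hv1 (by simp)) (Or.inr ENNReal.ofReal_ne_top)
    simpa using a1.add a2
  have hdu : MemLp (fun x => u (x + h) - u x) Q volume := (memLp_shift hu h).sub hu
  have hdG : MemLp (fun x => G (x + h) - G x) Q volume := (memLp_shift hG h).sub hG
  have hB : MemLp (fun x => (η x ^ 2) • (G (x + h) - G x) + 
      (2 * η x * (u (x + h) - u x)) • gradient η x) Q volume := by
    have b1 : MemLp (fun x => (η x ^ 2) • (G (x + h) - G x)) Q volume := by
      refine hdG.mono (Measurable.aestronglyMeasurable (by fun_prop)) (Eventually.of_forall fun x => ?_)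
      rw [norm_smul, Real.norm_of_nonneg (by positivity)]
      exact mul_le_of_le_one_left (by positivity) (hη2 x)
    have b2 : MemLp (fun x => (2 * η x * (u (x + h) - u x)) • gradient η x) Q volume := by
      refine (hdu.const_mul (2 * L)).mono (Measurable.aestronglyMeasurable (by fun_prop)) 
        (Eventually.of_forall fun x => ?_)
      rw [norm_smul, norm_mul, norm_mul, norm_mul, Real.norm_of_nonneg (hη0 x), 
        Real.norm_of_nonneg (show (0:ℝ) ≤ 2 by norm_num), Real.norm_of_nonneg (show 0 ≤ 2 * L by positivity)]
      calc 2 * η x * ‖u (x + h) - u x‖ * ‖gradient η x‖ ≤ 2 * 1 * ‖u (x + h) - u x‖ * L := by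
            gcongr
            · exact hη1 x
            · exact hL x
        _ = _ := by ring
    exact b1.add b2
  have hC : MemLp (fun x => η x ^ 2 * (u (x + h) - u x)) Q volume := by
    refine hdu.mono (Measurable.aestronglyMeasurable (by fun_prop)) (Eventually.of_forall fun x => ?_)
    rw [norm_mul, Real.norm_of_nonneg (show 0 ≤ η x ^ 2 by positivity)]
    exact mul_le_of_le_one_left (by positivity) (hη2 x)
  have l1 := tendsto_int_inner hpq ((memLp_shift hσ h).sub hσ) hB 
    (fun k => memLp_gradient (hψc k) (hψs k) Q) (by
      refine tendsto_of_tendsto_of_tendsto_of_le_of_le tendsto_const_nhds hdl (fun _ => zero_le) fun k => ?_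
      have c1 : eLpNorm (fun x => D k (x + h) - D k x) Q volume ≤ 2 * eLpNorm (D k) Q volume := 
        eLpNorm_diff_le hq1' (hDm k).aestronglyMeasurable h
      have c2 : eLpNorm (fun x => (2 * L) • ((v k (x + h) - u (x + h)) - (v k x - u x))) Q volume ≤ 
          ENNReal.ofReal (2 * L) * (2 * eLpNorm (fun x => v k x - u x) Q volume) := by
        refine (eLpNorm_const_smul_le (c := 2 * L) 
          (f := fun x => (v k (x + h) - u (x + h)) - (v k x - u x))).trans ?_
        rw [Real.enorm_of_nonneg (by positivity)]
        gcongr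
        exact eLpNorm_diff_le (w := fun x => v k x - u x) hq1' 
          (Measurable.aestronglyMeasurable (by fun_prop)) h
      refine le_trans ?_ (add_le_add c1 c2)
      rw [← eLpNorm_norm (fun x => D k (x + h) - D k x), 
        ← eLpNorm_norm (fun x => (2 * L) • ((v k (x + h) - u (x + h)) - (v k x - u x)))]
      refine le_trans (eLpNorm_mono_real fun x => ?_) (eLpNorm_add_le (Measurable.aestronglyMeasurable (by fun_prop)) 
        (Measurable.aestronglyMeasurable (by fun_prop)) hq1')
      have e1 : gradient (ψ k) x - ((η x ^ 2) • (G (x + h) - G x) + (2 * η x * (u (x + h) - u x)) • gradient η x)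
          = (η x ^ 2) • (D k (x + h) - D k x) + 
            (2 * η x * ((v k (x + h) - u (x + h)) - (v k x - u x))) • gradient η x := by
        rw [hψ, gradient_test hη (hv k)]
        by_cases h0 : η x = 0
        · simp [h0]
        · have hx := hsup x h0
          rw [mem_closedBall] at hx
          have hx1 : x ∈ ball z R2 := by rw [mem_ball]; linarith [norm_nonneg h]
          have hx2 : x + h ∈ ball z R2 := by
            rw [mem_ball]
            calc dist (x + h) z ≤ dist (x + h) x + dist x z := dist_triangle _ _ _
              _ < R2 := by rw [dist_eq_norm, add_sub_cancel_left]; linarith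
          simp only [hD, Set.indicator_of_mem hx1, Set.indicator_of_mem hx2]
          module
      rw [e1]
      refine (norm_add_le _ _).trans ?_
      simp only [Pi.add_apply]
      gcongr
      · rw [norm_smul, Real.norm_of_nonneg (by positivity)]
        exact mul_le_of_le_one_left (by positivity) (hη2 x)
      · rw [norm_smul, norm_mul, norm_mul, norm_smul, Real.norm_of_nonneg (hη0 x), 
          Real.norm_of_nonneg (show (0:ℝ) ≤ 2 by norm_num), Real.norm_of_nonneg (show 0 ≤ 2 * L by positivity)]
        calc _ ≤ 2 * 1 * ‖(v k (x + h) - u (x + h)) - (v k x - u x)‖ * L := by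
              gcongr
              · exact hη1 x
              · exact hL x
          _ = _ := by ring)
  have l2 := tendsto_int_inner hpq ((memLp_shift hf h).sub hf) hC 
    (fun k => (hψc k).continuous.memLp_of_hasCompactSupport (hψs k)) (by
      have hdl2 : Tendsto (fun k => 2 * eLpNorm (fun x => v k x - u x) Q volume) atTop (𝓝 0) := by
        simpa using ENNReal.Tendsto.const_mul (a := 2) hv1 (by simp)
      refine tendsto_of_tendsto_of_tendsto_of_le_of_le tendsto_const_nhds hdl2 (fun _ => zero_le) fun k => ?_
      refine le_trans ?_ (eLpNorm_diff_le (w := fun x => v k x - u x) hq1' 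
          (Measurable.aestronglyMeasurable (by fun_prop)) h)
      apply eLpNorm_mono
      intro x
      have : ψ k x - η x ^ 2 * (u (x + h) - u x) = η x ^ 2 * (v k (x + h) - u (x + h) - (v k x - u x)) := by
        simp only [hψ]; ring
      rw [this, norm_mul, Real.norm_of_nonneg (by positivity)]
      exact mul_le_of_le_one_left (by positivity) (hη2 x))
  have l3 : Tendsto (fun k => ∫ x, ⟪σ (x + h) - σ x, gradient (ψ k) x⟫) atTop 
      (𝓝 (∫ x, (f (x + h) - f x) * (η x ^ 2 * (u (x + h) - u x)))) := by
    simp_rw [hk]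
    simpa [mul_comm] using l2
  exact tendsto_nhds_unique l1 l3

end PartF

section PartG
open Filter Topology

variable {n : ℕ}
local notation "𝔼" => EuclideanSpace ℝ (Fin n)

lemma local_energy {p q α A : ℝ} (hpq : p.HolderConjugate q) (hp : p = q / (q - 1)) (hq1 : 1 < q) (hq2 : q < 2)
    (hα : 1 + α ≤ q) {G : 𝔼 → 𝔼} {u f : 𝔼 → ℝ} 
    (hum : Measurable u) (hGm : Measurable G) (hu : MemLp u (ENNReal.ofReal q) volume) 
    (hG : MemLp G (ENNReal.ofReal q) volume) (hf : MemLp f (ENNReal.ofReal p) volume) {z : 𝔼} {r : ℝ} 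
    (hr : 0 < r) (hr1 : r ≤ 1) (hA : 0 ≤ A)
    (hwk : ∀ φ : 𝔼 → ℝ, ContDiff ℝ 1 φ → HasCompactSupport φ → tsupport φ ⊆ ball z (6 * r) →
      ∫ x, u x • gradient φ x = -∫ x, φ x • G x)
    (hsol : ∀ φ : 𝔼 → ℝ, ContDiff ℝ 1 φ → HasCompactSupport φ → tsupport φ ⊆ ball z (6 * r) →
      ∫ x, ⟪Hmap n (q - 1) (G x), gradient φ x⟫ = ∫ x, f x * φ x) 
    (hfd : ∀ h : 𝔼, ‖h‖ ≤ r → eLpNorm (fun x => f (x + h) - f x) (ENNReal.ofReal p) 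
      (volume.restrict (ball z (3 * r))) ≤ ENNReal.ofReal (A * ‖h‖ ^ α)) :
    ∃ C : ℝ, 0 ≤ C ∧ ∀ h : 𝔼, ‖h‖ ≤ r → 
      ∫⁻ x in ball z (2 * r), ‖Hmap n (q / 2) (G (x + h)) - Hmap n (q / 2) (G x)‖ₑ ^ 2 ≤ 
        ENNReal.ofReal (C * ‖h‖ ^ (1 + α)) := by
  have hq0 : 0 < q := by linarith
  have hp2 : 2 ≤ p := by
    rw [hp, le_div_iff₀ (by linarith)]; linarith
  have hσ : MemLp (fun x => Hmap n (q - 1) (G x)) (ENNReal.ofReal p) volume := 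
    memLp_Hmap (by linarith) hp hGm hG
  have hV : MemLp (fun x => Hmap n (q / 2) (G x)) (ENNReal.ofReal 2) volume := 
    memLp_Hmap (by linarith) (by field_simp) hGm hG
  set η : ContDiffBump z := ⟨2 * r, 3 * r, by linarith, by linarith⟩ with hη
  have hηc : ContDiff ℝ 1 (η : 𝔼 → ℝ) := η.contDiff
  have hηt : tsupport (η : 𝔼 → ℝ) ⊆ closedBall z (3 * r) := η.tsupport_eq.le
  have hη0 : ∀ x ∉ ball z (3 * r), η x = 0 := by
    intro x hx
    have : x ∉ Function.support (η : 𝔼 → ℝ) := by rwa [η.support_eq]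
    simpa using this
  obtain ⟨L, hL⟩ : ∃ L, ∀ x, ‖gradient (η : 𝔼 → ℝ) x‖ ≤ L := by
    obtain ⟨L, hL⟩ := (((η.hasCompactSupport.fderiv ℝ).comp_left 
      (g := (InnerProductSpace.toDual ℝ 𝔼).symm) (map_zero _))).exists_bound_of_continuous 
      (continuous_gradient hηc)
    exact ⟨L, hL⟩
  have hL0 : 0 ≤ L := (norm_nonneg _).trans (hL 0)
  set M := (eLpNorm G (ENNReal.ofReal q) volume).toReal with hM
  have hM0 : 0 ≤ M := ENNReal.toReal_nonneg
  have hMe : eLpNorm G (ENNReal.ofReal q) volume = ENNReal.ofReal M := (ENNReal.ofReal_toReal hG.2.ne).symm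
  set K := (2 * L / (((q - 1) / 2) ^ (1 / p) / 3)) ^ q with hK
  have hK0 : 0 ≤ K := by
    have : 0 < (q - 1) / 2 := by linarith
    positivity
  set C := 2 / (q - 1) * (A * M + K * M ^ q) with hC
  have hq1' : 0 < q - 1 := by linarith
  have hC0 : 0 ≤ C := by positivity
  refine ⟨C, hC0, fun h hh => ?_⟩
  set μ := (volume : Measure 𝔼).restrict (ball z (3 * r)) with hμ
  have hid := limit_eq (R1 := 3 * r) (R2 := 5 * r) (h := h) hpq hq1 hum hGm hu hG hσ hf hwk hsol (by linarith) 
    (by linarith) hηc hηt (fun x => η.nonneg) (fun x => η.le_one) hL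
  have hdV := ((memLp_shift hV h).sub hV).mono_measure (Measure.restrict_le_self (s := ball z (3 * r)))
  have hen := energy_est (μ := μ) hpq hp2 hq1 hL0 
    (((memLp_shift hσ h).sub hσ).mono_measure Measure.restrict_le_self)
    (((memLp_shift hG h).sub hG).mono_measure Measure.restrict_le_self)
    hdV
    (((memLp_shift hu h).sub hu).mono_measure Measure.restrict_le_self)
    (((memLp_shift hf h).sub hf).mono_measure Measure.restrict_le_self)
    hηc.continuous.aestronglyMeasurable (continuous_gradient hηc).aestronglyMeasurable
    (fun x => η.nonneg) (fun x => η.le_one) hL 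
    (fun x => by simpa using Hmap_mono hq1 hq2 (G (x + h)) (G x)) 
    (fun x => by simpa using Hmap_holder hq1 hq2 hp (G (x + h)) (G x))
    (by
      rw [hμ, setIntegral_eq_integral_of_forall_compl_eq_zero, setIntegral_eq_integral_of_forall_compl_eq_zero]
      · exact hid
      · intro x hx; simp [hη0 x hx]
      · intro x hx; simp [hη0 x hx])
  have hdu : (eLpNorm ((fun x => u (x + h)) - u) (ENNReal.ofReal q) μ).toReal ≤ ‖h‖ * M := by
    have h1 := diff_sobolev (R1 := 3 * r) (h := h) hq1.le hum hGm hu hG (by linarith) hwk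
    rw [hMe, ← ofReal_norm, ← ENNReal.ofReal_mul (norm_nonneg _)] at h1
    exact ENNReal.toReal_le_of_le_ofReal (by positivity) h1
  have hdf : (eLpNorm ((fun x => f (x + h)) - f) (ENNReal.ofReal p) μ).toReal ≤ A * ‖h‖ ^ α := 
    ENNReal.toReal_le_of_le_ofReal (by positivity) (hfd h hh)
  set I := ∫ x, η x ^ 2 * ‖((fun x => Hmap n (q / 2) (G (x + h))) - fun x => Hmap n (q / 2) (G x)) x‖ ^ 2 ∂μ with hI
  have hIC : I ≤ C * ‖h‖ ^ (1 + α) := by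
    have h2 : (q - 1) / 2 * I ≤ A * ‖h‖ ^ α * (‖h‖ * M) + K * (‖h‖ * M) ^ q := by
      refine hen.trans ?_
      gcongr
    have h3 : ‖h‖ ^ α * ‖h‖ ≤ ‖h‖ ^ (1 + α) := by
      rcases (norm_nonneg h).eq_or_lt with h0 | h0
      · rw [← h0]; simp; positivity
      · rw [Real.rpow_add h0, Real.rpow_one, mul_comm]
    have h4 : ‖h‖ ^ q ≤ ‖h‖ ^ (1 + α) := by
      rcases (norm_nonneg h).eq_or_lt with h0 | h0
      · rw [← h0, Real.zero_rpow hq0.ne']; positivity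
      · exact Real.rpow_le_rpow_of_exponent_ge h0 (hh.trans hr1) hα
    have h5 : (q - 1) / 2 * I ≤ (A * M + K * M ^ q) * ‖h‖ ^ (1 + α) := by
      rw [Real.mul_rpow (norm_nonneg _) hM0] at h2
      calc _ ≤ _ := h2
        _ = A * M * (‖h‖ ^ α * ‖h‖) + K * M ^ q * ‖h‖ ^ q := by ring
        _ ≤ A * M * ‖h‖ ^ (1 + α) + K * M ^ q * ‖h‖ ^ (1 + α) := by gcongr
        _ = _ := by ring
    calc I = 2 / (q - 1) * ((q - 1) / 2 * I) := by field_simp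
      _ ≤ 2 / (q - 1) * ((A * M + K * M ^ q) * ‖h‖ ^ (1 + α)) := by gcongr
      _ = _ := by rw [hC]; ring
  refine le_trans ?_ (ENNReal.ofReal_le_ofReal hIC)
  rw [hI, ofReal_integral_eq_lintegral_ofReal]
  · calc _ ≤ ∫⁻ x in ball z (2 * r), ENNReal.ofReal (η x ^ 2 * 
          ‖((fun x => Hmap n (q / 2) (G (x + h))) - fun x => Hmap n (q / 2) (G x)) x‖ ^ 2) := by
          apply setLIntegral_mono' measurableSet_ball
          intro x hx
          rw [η.one_of_mem_closedBall (ball_subset_closedBall hx), one_pow, one_mul, 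
            ENNReal.ofReal_pow (norm_nonneg _), ofReal_norm]
          rfl
      _ ≤ _ := lintegral_mono_set (ball_subset_ball (by linarith))
  · have h6 : Integrable (fun x => 
        ‖((fun x => Hmap n (q / 2) (G (x + h))) - fun x => Hmap n (q / 2) (G x)) x‖ ^ 2) μ := by
      simpa using (int_rpow_eq (by norm_num) hdV).1
    refine h6.mono' ((hηc.continuous.aestronglyMeasurable.pow 2).mul h6.1) (Eventually.of_forall fun x => ?_)
    rw [Real.norm_of_nonneg (by positivity)]
    exact mul_le_of_le_one_left (by positivity) (pow_le_one₀ η.nonneg η.le_one)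
  · exact Eventually.of_forall fun x => by positivity

lemma local_main (hn : 2 ≤ n) {p q α A s : ℝ} (hp : p = q / (q - 1)) (hq1 : 1 < q) (hq2 : q < 2)
    (hα0 : 0 < α) (hα : 1 + α ≤ q) {G : 𝔼 → 𝔼} {u f : 𝔼 → ℝ} 
    (hum : Measurable u) (hGm : Measurable G) (hu : MemLp u (ENNReal.ofReal q) volume) 
    (hG : MemLp G (ENNReal.ofReal q) volume) (hf : MemLp f (ENNReal.ofReal p) volume) {z : 𝔼} {r : ℝ} 
    (hr : 0 < r) (hr1 : r ≤ 1) (hA : 0 ≤ A)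
    (hwk : ∀ φ : 𝔼 → ℝ, ContDiff ℝ 1 φ → HasCompactSupport φ → tsupport φ ⊆ ball z (6 * r) →
      ∫ x, u x • gradient φ x = -∫ x, φ x • G x)
    (hsol : ∀ φ : 𝔼 → ℝ, ContDiff ℝ 1 φ → HasCompactSupport φ → tsupport φ ⊆ ball z (6 * r) →
      ∫ x, ⟪Hmap n (q - 1) (G x), gradient φ x⟫ = ∫ x, f x * φ x) 
    (hfd : ∀ h : 𝔼, ‖h‖ ≤ r → eLpNorm (fun x => f (x + h) - f x) (ENNReal.ofReal p) 
      (volume.restrict (ball z (3 * r))) ≤ ENNReal.ofReal (A * ‖h‖ ^ α)) 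
    (hs0 : 0 < s) (hs : s * ((n : ℝ) - 1 - α) < n * p) :
    IntegrableOn (fun x => ‖Hmap n (q - 1) (G x)‖ ^ s) (ball z r) volume := by
  have hq1' : 0 < q - 1 := by linarith
  have hp0 : 0 < p := by rw [hp]; exact div_pos (by linarith) hq1'
  have hpq : p.HolderConjugate q := by
    have := (Real.HolderConjugate.conjExponent hq1).symm
    rwa [Real.conjExponent, ← hp] at this
  obtain ⟨C, hC, hE⟩ := local_energy hpq hp hq1 hq2 hα hum hGm hu hG hf hr hr1 hA hwk hsol hfd
  have hn' : (2 : ℝ) ≤ n := by exact_mod_cast hn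
  have hV : MemLp (fun x => Hmap n (q / 2) (G x)) 2 volume := by
    have := memLp_Hmap (n := n) (q := q) (a := q / 2) (b := 2) (by linarith) (by field_simp) hGm hG
    simpa using this
  have key := nikolskii_embed (n := n) (w := fun x => ‖Hmap n (q / 2) (G x)‖) (z := z) (r := r) (θ := (1 + α) / 2) 
    (C := C) (t := 2 * s / p) (by omega) (((measurable_Hmap _).comp hGm).norm) hV.norm hr (by linarith) (by linarith) 
    hC (fun h hh => by
      rw [show 2 * ((1 + α) / 2) = 1 + α by ring]
      refine le_trans (lintegral_mono fun x => ?_) (hE h hh)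
      gcongr
      rw [← ofReal_norm, ← ofReal_norm]
      apply ENNReal.ofReal_le_ofReal
      rw [Real.norm_eq_abs]
      exact abs_norm_sub_norm_le _ _) (by positivity) (by
      rw [show 2 * s / p * ((n:ℝ) / 2 - (1 + α) / 2) = (s * ((n : ℝ) - 1 - α)) / p by field_simp; ring, 
        div_lt_iff₀ hp0]
      exact hs)
  refine key.congr_fun (fun x _ => ?_) measurableSet_ball
  have hm : 0 ≤ max (‖G x‖ - 1) 0 := le_max_right _ _
  simp only
  rw [abs_of_nonneg (norm_nonneg _), norm_Hmap (by linarith), norm_Hmap hq1', ← Real.rpow_mul hm, ← Real.rpow_mul hm]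
  congr 1
  rw [hp]; field_simp

end PartG

section PartK
open Filter Topology

variable {n : ℕ}
local notation "𝔼" => EuclideanSpace ℝ (Fin n)

lemma loc_int {E : Type*} [NormedAddCommGroup E] [NormedSpace ℝ E] {Ω B s : Set 𝔼} (hB : MeasurableSet B) 
    (hBΩ : B ⊆ Ω) (hsB : s ⊆ B) {F F' : 𝔼 → E} (h1 : ∀ x ∉ s, F x = 0) (h2 : ∀ x ∉ s, F' x = 0)
    (he : ∀ᵐ x ∂(volume.restrict B), F x = F' x) : ∫ x in Ω, F x = ∫ x, F' x := by
  rw [setIntegral_eq_integral_of_forall_compl_eq_zero fun x hx => h1 x fun h => hx (hBΩ (hsB h)), 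
    ← setIntegral_eq_integral_of_forall_compl_eq_zero (s := B) fun x hx => h1 x fun h => hx (hsB h), 
    ← setIntegral_eq_integral_of_forall_compl_eq_zero (s := B) (f := F') fun x hx => h2 x fun h => hx (hsB h)]
  exact integral_congr_ae he

lemma gradient_zero_off {φ : 𝔼 → ℝ} {x : 𝔼} (hx : x ∉ tsupport φ) : gradient φ x = 0 := by
  have : fderiv ℝ φ x = 0 := by
    by_contra h
    exact hx (support_fderiv_subset ℝ h)
  rw [gradient, this, map_zero]

/-- a global measurable representative -/
lemma exists_rep {E : Type*} [NormedAddCommGroup E] [MeasurableSpace E] [BorelSpace E] {Q : ℝ≥0∞} {B : Set 𝔼} 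
    (hB : MeasurableSet B) {g : 𝔼 → E} (hg : MemLp g Q (volume.restrict B)) : 
    ∃ g' : 𝔼 → E, Measurable g' ∧ MemLp g' Q volume ∧ ∀ᵐ x ∂(volume.restrict B), g' x = g x := by
  have hm : ∀ᵐ x ∂(volume.restrict B), B.indicator (hg.1.mk g) x = g x := by
    filter_upwards [hg.1.ae_eq_mk, ae_restrict_mem hB] with x h1 h2
    rw [Set.indicator_of_mem h2, h1]
  refine ⟨B.indicator (hg.1.mk g), hg.1.stronglyMeasurable_mk.measurable.indicator hB, ?_, hm⟩
  rw [memLp_indicator_iff_restrict hB]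
  exact hg.ae_eq hg.1.ae_eq_mk

lemma weak_rep {q : ℝ} {Ω : Set 𝔼} {u : 𝔼 → ℝ} {Du : 𝔼 → 𝔼} (hu : MemW1Loc n q Ω u Du) {z : 𝔼} {R R' : ℝ} 
    (hRR : R ≤ R') (hB : closedBall z R' ⊆ Ω) {u' : 𝔼 → ℝ} {G : 𝔼 → 𝔼} 
    (hu' : ∀ᵐ x ∂(volume.restrict (closedBall z R')), u' x = u x) 
    (hG : ∀ᵐ x ∂(volume.restrict (closedBall z R')), G x = Du x) :
    ∀ φ : 𝔼 → ℝ, ContDiff ℝ 1 φ → HasCompactSupport φ → tsupport φ ⊆ ball z R →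
      ∫ x, u' x • gradient φ x = -∫ x, φ x • G x := by
  intro φ hφ hc ht
  have hsub : ball z R ⊆ closedBall z R' := (ball_subset_ball hRR).trans ball_subset_closedBall
  have h := hu.2 φ hφ hc (ht.trans (hsub.trans hB))
  have e0 : ∀ x ∉ ball z R, φ x = 0 := fun x hx => image_eq_zero_of_notMem_tsupport fun h => hx (ht h)
  have e1 : ∀ x ∉ ball z R, gradient φ x = 0 := fun x hx => gradient_zero_off fun h => hx (ht h)
  rw [loc_int measurableSet_closedBall hB hsub (F' := fun x => u' x • gradient φ x) 
      (fun x hx => by simp [e1 x hx]) (fun x hx => by simp [e1 x hx]) 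
      (by filter_upwards [hu'] with x hx; rw [hx]),
    loc_int measurableSet_closedBall hB hsub (F' := fun x => φ x • G x) 
      (fun x hx => by simp [e0 x hx]) (fun x hx => by simp [e0 x hx]) 
      (by filter_upwards [hG] with x hx; rw [hx])] at h
  exact h

lemma local_reduction (hn : 2 ≤ n) {p q α A s : ℝ} (hp : p = q / (q - 1)) (hq1 : 1 < q) (hq2 : q < 2)
    (hα0 : 0 < α) (hα : 1 + α ≤ q) {Ω : Set 𝔼} {Du : 𝔼 → 𝔼} {u f F : 𝔼 → ℝ} 
    (hu : MemW1Loc n q Ω u Du) (hsol : IsLocalWeakSolution n q Ω Du f) {z : 𝔼} {r : ℝ} 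
    (hr : 0 < r) (hr1 : r ≤ 1) (hA : 0 ≤ A) (hB : closedBall z (10 * r) ⊆ Ω)
    (hF : MemLp F (ENNReal.ofReal p) volume) 
    (hFf : ∀ᵐ x ∂(volume.restrict (closedBall z (10 * r))), F x = f x) 
    (hfd : ∀ h : 𝔼, ‖h‖ ≤ r → eLpNorm (fun x => F (x + h) - F x) (ENNReal.ofReal p) 
      (volume.restrict (ball z (3 * r))) ≤ ENNReal.ofReal (A * ‖h‖ ^ α)) 
    (hs0 : 0 < s) (hs : s * ((n : ℝ) - 1 - α) < n * p) :
    IntegrableOn (fun x => ‖Hmap n (q - 1) (Du x)‖ ^ s) (ball z r) volume := by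
  obtain ⟨h1, h2⟩ := hu.1 _ (isCompact_closedBall z (10 * r)) hB
  obtain ⟨u', hu'm, hu'L, hu'⟩ := exists_rep measurableSet_closedBall h1
  obtain ⟨G, hGm, hGL, hG⟩ := exists_rep measurableSet_closedBall h2
  have hsub : ball z (6 * r) ⊆ closedBall z (10 * r) := 
    (ball_subset_ball (by linarith)).trans ball_subset_closedBall
  have key := local_main hn hp hq1 hq2 hα0 hα hu'm hGm hu'L hGL hF hr hr1 hA 
    (weak_rep hu (by linarith) hB hu' hG) (by
      intro φ hφ hc ht
      have h := hsol φ hφ hc (ht.trans (hsub.trans hB))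
      have e0 : ∀ x ∉ ball z (6 * r), φ x = 0 := fun x hx => image_eq_zero_of_notMem_tsupport fun h => hx (ht h)
      have e1 : ∀ x ∉ ball z (6 * r), gradient φ x = 0 := fun x hx => gradient_zero_off fun h => hx (ht h)
      rw [loc_int measurableSet_closedBall hB hsub (F' := fun x => ⟪Hmap n (q - 1) (G x), gradient φ x⟫) 
          (fun x hx => by simp [e1 x hx]) (fun x hx => by simp [e1 x hx]) 
          (by filter_upwards [hG] with x hx; rw [hx]),
        loc_int measurableSet_closedBall hB hsub (F' := fun x => F x * φ x) 
          (fun x hx => by simp [e0 x hx]) (fun x hx => by simp [e0 x hx]) 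
          (by filter_upwards [hFf] with x hx; rw [hx])] at h
      exact h) hfd hs0 hs
  have hsub' : ball z r ⊆ closedBall z (10 * r) := 
    (ball_subset_ball (by linarith)).trans ball_subset_closedBall
  refine key.congr_fun_ae ?_
  filter_upwards [ae_restrict_of_ae_restrict_of_subset hsub' hG] with x hx
  rw [hx]

lemma cover_integrable {Ω K : Set 𝔼} (hΩ : IsOpen Ω) (hK : IsCompact K) (hKΩ : K ⊆ Ω) {g : 𝔼 → ℝ} 
    (h : ∀ z r, 0 < r → r ≤ 1 → closedBall z (20 * r) ⊆ Ω → IntegrableOn g (ball z r) volume) :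
    IntegrableOn g K volume := by
  apply LocallyIntegrableOn.integrableOn_isCompact _ hK
  intro z hz
  obtain ⟨ε, hε, hb⟩ := Metric.isOpen_iff.1 hΩ z (hKΩ hz)
  set r := min (ε / 40) 1 with hr
  have hr0 : 0 < r := lt_min (by linarith) one_pos
  have hr2 : r ≤ ε / 40 := min_le_left _ _
  refine ⟨ball z r, mem_nhdsWithin_of_mem_nhds (ball_mem_nhds z hr0), 
    h z r hr0 (min_le_right _ _) ((closedBall_subset_ball (by linarith)).trans hb)⟩

lemma memLp_Hmap' {q a b : ℝ} (ha : 0 < a) (hb : b = q / a) {G : 𝔼 → 𝔼} {μ : Measure 𝔼}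
    (hG : MemLp G (ENNReal.ofReal q) μ) : MemLp (fun x => Hmap n a (G x)) (ENNReal.ofReal b) μ := by
  have h1 := hG.norm_rpow_div (ENNReal.ofReal a)
  rw [ENNReal.toReal_ofReal ha.le, ← ENNReal.ofReal_div_of_pos ha, ← hb] at h1
  refine h1.mono ((measurable_Hmap a).comp_aemeasurable hG.1.aemeasurable).aestronglyMeasurable 
    (Eventually.of_forall fun x => ?_)
  rw [norm_Hmap ha, Real.norm_of_nonneg (by positivity)]
  apply Real.rpow_le_rpow (le_max_right _ _) _ ha.le
  apply max_le _ (norm_nonneg _)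
  linarith

lemma zero_sol {p q : ℝ} (hp : p = q / (q - 1)) (hq1 : 1 < q) {Ω : Set 𝔼} {Du : 𝔼 → 𝔼} {u f : 𝔼 → ℝ} 
    (hu : MemW1Loc n q Ω u Du) (hsol : IsLocalWeakSolution n q Ω Du f) {z : 𝔼} {r : ℝ} 
    (hr : 0 < r) (hB : closedBall z (20 * r) ⊆ Ω)
    (hnm : ¬ AEStronglyMeasurable f (volume.restrict (closedBall z (10 * r)))) : 
    IsLocalWeakSolution n q Ω Du (fun _ => 0) := by
  have hq1' : 0 < q - 1 := by linarith
  have hpq : p.HolderConjugate q := by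
    have := (Real.HolderConjugate.conjExponent hq1).symm
    rwa [Real.conjExponent, ← hp] at this
  set η : ContDiffBump z := ⟨10 * r, 20 * r, by linarith, by linarith⟩ with hη
  have hηc : ContDiff ℝ 1 (η : 𝔼 → ℝ) := η.contDiff
  have hηt : tsupport (η : 𝔼 → ℝ) ⊆ Ω := η.tsupport_eq.le.trans hB
  have hsub : closedBall z (10 * r) ⊆ Ω := (closedBall_subset_closedBall (by linarith)).trans hB
  have hni : ¬ Integrable (fun x => f x * η x) (volume.restrict Ω) := by
    intro hI
    apply hnm
    refine (hI.1.mono_measure (Measure.restrict_mono hsub le_rfl)).congr ?_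
    filter_upwards [ae_restrict_mem measurableSet_closedBall] with x hx
    rw [η.one_of_mem_closedBall hx, mul_one]
  have hIntg : ∀ φ : 𝔼 → ℝ, ContDiff ℝ 1 φ → HasCompactSupport φ → tsupport φ ⊆ Ω → 
      Integrable (fun x => ⟪Hmap n (q - 1) (Du x), gradient φ x⟫) (volume.restrict Ω) := by
    intro φ hφ hc ht
    have h1 := memLp_Hmap' hq1' hp (hu.1 _ hc ht).2
    have h2 := (memLp_gradient hφ hc (ENNReal.ofReal q)).mono_measure 
      (Measure.restrict_le_self (s := tsupport φ))
    have h3 := int_inner hpq h1 h2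
    have h4 : Integrable (fun x => ⟪Hmap n (q - 1) (Du x), gradient φ x⟫) volume := 
      IntegrableOn.integrable_of_forall_notMem_eq_zero h3 
        (fun x hx => by rw [gradient_zero_off hx, inner_zero_right])
    exact h4.mono_measure Measure.restrict_le_self
  have h0 : ∫ x in Ω, ⟪Hmap n (q - 1) (Du x), gradient (η : 𝔼 → ℝ) x⟫ = 0 := by
    rw [hsol η hηc η.hasCompactSupport hηt, integral_undef hni]
  intro φ hφ hc ht
  simp only [zero_mul, integral_zero]
  by_cases hI : Integrable (fun x => f x * φ x) (volume.restrict Ω)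
  · have hni2 : ¬ Integrable (fun x => f x * (φ + ⇑η) x) (volume.restrict Ω) := by
      intro h
      apply hni
      refine (h.sub hI).congr (Eventually.of_forall fun x => ?_)
      simp; ring
    have hts : tsupport (φ + ⇑η) ⊆ Ω := (tsupport_add _ _).trans (Set.union_subset ht hηt)
    have h1 := hsol (φ + ⇑η) (hφ.add hηc) (hc.add η.hasCompactSupport) hts
    rw [integral_undef hni2] at h1
    have hg : ∀ x, gradient (φ + ⇑η) x = gradient φ x + gradient (η : 𝔼 → ℝ) x := by
      intro x
      have := ((hφ.differentiable one_ne_zero x).hasFDerivAt.add (hηc.differentiable one_ne_zero x).hasFDerivAt).fderiv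
      rw [gradient, this, map_add]; rfl
    simp_rw [hg, inner_add_right] at h1
    rw [integral_add (hIntg φ hφ hc ht) (hIntg η hηc η.hasCompactSupport hηt), h0, add_zero] at h1
    exact h1
  · rw [hsol φ hφ hc ht, integral_undef hI]

end PartK

section PartL
open Filter Topology

variable {n : ℕ}
local notation "𝔼" => EuclideanSpace ℝ (Fin n)

lemma besov_diff {p α r : ℝ} (hp : 1 < p) {f F : 𝔼 → ℝ} {z : 𝔼} (hr : 0 < r)
    (hF : MemLp F (ENNReal.ofReal p) volume) 
    (hFf : ∀ᵐ x ∂(volume.restrict (closedBall z (10 * r))), F x = f x) 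
    (hbd : BddAbove (besovSet n p α (ball z (5 * r)) f)) :
    ∃ A : ℝ, 0 ≤ A ∧ ∀ (s : Fin n) (t : ℝ), |t| ≤ r → 
      eLpNorm (fun x => F (x + t • unitVec n s) - F x) (ENNReal.ofReal p) (volume.restrict (ball z (5 * r))) ≤ 
        ENNReal.ofReal (A * |t| ^ α) := by
  have hp0 : 0 < p := by linarith
  obtain ⟨A, hA⟩ := hbd
  refine ⟨max A 0, le_max_right _ _, fun s t ht => ?_⟩
  by_cases h0 : t = 0
  · simp [h0]
  set e := t • unitVec n s with he
  have hen : ‖e‖ ≤ r := by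
    rw [he, norm_smul, unitVec]
    simpa using ht
  have hsh : ∀ᵐ x ∂(volume.restrict (ball z (5 * r))), F (x + e) = f (x + e) ∧ F x = f x := by
    rw [ae_restrict_iff' measurableSet_closedBall] at hFf
    have h2 := (measurePreserving_add_right volume e).quasiMeasurePreserving.ae hFf
    rw [ae_restrict_iff' measurableSet_ball]
    filter_upwards [hFf, h2] with x hx1 hx2 hx
    rw [mem_ball] at hx
    refine ⟨hx2 ?_, hx1 ?_⟩
    · rw [mem_closedBall]
      calc dist (x + e) z ≤ dist (x + e) x + dist x z := dist_triangle _ _ _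
        _ ≤ 10 * r := by rw [dist_eq_norm, add_sub_cancel_left]; linarith
    · rw [mem_closedBall]; linarith
  have hd : MemLp (fun x => F (x + e) - F x) (ENNReal.ofReal p) (volume.restrict (ball z (5 * r))) := 
    ((memLp_shift hF e).sub hF).mono_measure Measure.restrict_le_self
  have hI := (int_rpow_eq hp0 hd).2
  set N := (eLpNorm (fun x => F (x + e) - F x) (ENNReal.ofReal p) (volume.restrict (ball z (5 * r)))).toReal with hN
  have hN0 : 0 ≤ N := ENNReal.toReal_nonneg
  have ht0 : 0 < |t| := abs_pos.2 h0
  have h1 := hA ⟨s, t, h0, rfl⟩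
  have e1 : ∫ x in ball z (5 * r), |f (x + t • unitVec n s) - f x| ^ p / |t| ^ (α * p) = 
      N ^ p / |t| ^ (α * p) := by
    rw [← hI, ← integral_div]
    apply integral_congr_ae
    filter_upwards [hsh] with x hx
    rw [← hx.2, ← he, ← hx.1, Real.norm_eq_abs]
  rw [e1, Real.rpow_mul ht0.le, ← Real.div_rpow hN0 (by positivity), one_div, 
    Real.rpow_rpow_inv (by positivity) hp0.ne', div_le_iff₀ (by positivity)] at h1
  rw [← ENNReal.ofReal_toReal hd.2.ne]
  apply ENNReal.ofReal_le_ofReal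
  refine h1.trans ?_
  gcongr
  exact le_max_left _ _

lemma eLpNorm_shift_ball {Q : ℝ≥0∞} {g : 𝔼 → ℝ} (hg : AEStronglyMeasurable g volume) {z y : 𝔼} {R R' : ℝ} 
    (hR : R + ‖y‖ ≤ R') : 
    eLpNorm (fun x => g (x + y)) Q (volume.restrict (ball z R)) ≤ eLpNorm g Q (volume.restrict (ball z R')) := by
  rw [← eLpNorm_indicator_eq_eLpNorm_restrict measurableSet_ball, 
    ← eLpNorm_indicator_eq_eLpNorm_restrict measurableSet_ball, 
    ← eLpNorm_shift (hg.indicator measurableSet_ball) y]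
  apply eLpNorm_mono
  intro x
  by_cases hx : x ∈ ball z R
  · have : x + y ∈ ball z R' := by
      rw [mem_ball] at hx ⊢
      calc dist (x + y) z ≤ dist (x + y) x + dist x z := dist_triangle _ _ _
        _ < R' := by rw [dist_eq_norm, add_sub_cancel_left]; linarith
    rw [Set.indicator_of_mem hx, Set.indicator_of_mem this]
  · rw [Set.indicator_of_notMem hx]; simp

lemma partial_apply (h : 𝔼) (T : Finset (Fin n)) (i : Fin n) : 
    (∑ s ∈ T, h s • unitVec n s) i = if i ∈ T then h i else 0 := by
  rw [WithLp.ofLp_sum, Finset.sum_apply]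
  simp [unitVec, Pi.single_apply]

lemma partial_norm (h : 𝔼) (T : Finset (Fin n)) : ‖∑ s ∈ T, h s • unitVec n s‖ ≤ ‖h‖ := by
  rw [EuclideanSpace.norm_eq, EuclideanSpace.norm_eq]
  apply Real.sqrt_le_sqrt
  apply Finset.sum_le_sum
  intro i _
  rw [partial_apply]
  split_ifs
  · rfl
  · simp; positivity

lemma telescope {p α r A : ℝ} (hp : 1 < p) (hα : 0 < α) {F : 𝔼 → ℝ} {z : 𝔼} (hA : 0 ≤ A)
    (hF : MemLp F (ENNReal.ofReal p) volume) 
    (hd : ∀ (s : Fin n) (t : ℝ), |t| ≤ r → 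
      eLpNorm (fun x => F (x + t • unitVec n s) - F x) (ENNReal.ofReal p) (volume.restrict (ball z (5 * r))) ≤ 
        ENNReal.ofReal (A * |t| ^ α)) (h : 𝔼) (hh : ‖h‖ ≤ r) :
    eLpNorm (fun x => F (x + h) - F x) (ENNReal.ofReal p) (volume.restrict (ball z (3 * r))) ≤ 
        ENNReal.ofReal (n * A * ‖h‖ ^ α) := by
  have hp1 : 1 ≤ ENNReal.ofReal p := by simpa using hp.le
  have hr0 : 0 ≤ r := (norm_nonneg h).trans hh
  have key : ∀ T : Finset (Fin n), eLpNorm (fun x => F (x + ∑ s ∈ T, h s • unitVec n s) - F x) (ENNReal.ofReal p) 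
      (volume.restrict (ball z (3 * r))) ≤ T.card * ENNReal.ofReal (A * ‖h‖ ^ α) := by
    intro T
    induction T using Finset.induction_on with
    | empty => simp
    | insert a T ha ih => 
      set y := ∑ s ∈ T, h s • unitVec n s with hy
      have hyn : ‖y‖ ≤ ‖h‖ := partial_norm h T
      set g : 𝔼 → ℝ := fun x => F (x + h a • unitVec n a) - F x with hg
      have hgm : AEStronglyMeasurable g volume := ((memLp_shift hF _).sub hF).1
      have e1 : (fun x => F (x + ∑ s ∈ insert a T, h s • unitVec n s) - F x) = 
          (fun x => g (x + y)) + (fun x => F (x + y) - F x) := by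
        ext x
        rw [Finset.sum_insert ha]
        simp only [hg, Pi.add_apply, ← hy]
        rw [show x + (h a • unitVec n a + y) = x + y + h a • unitVec n a by abel]
        ring
      rw [e1]
      have m1 : AEStronglyMeasurable (fun x => g (x + y)) volume := 
        hgm.comp_measurePreserving (measurePreserving_add_right volume y)
      have m2 : AEStronglyMeasurable (fun x => F (x + y) - F x) volume := ((memLp_shift hF _).sub hF).1
      refine (eLpNorm_add_le m1.restrict m2.restrict hp1).trans ?_
      rw [Finset.card_insert_of_notMem ha]
      push_cast
      rw [add_mul, one_mul, add_comm (_ * _)]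
      gcongr ?_ + ?_
      · have hha : |h a| ≤ ‖h‖ := by
          have := PiLp.norm_apply_le h a
          simpa using this
        refine (eLpNorm_shift_ball hgm (R' := 5 * r) (by linarith)).trans ((hd a (h a) (by linarith)).trans ?_)
        apply ENNReal.ofReal_le_ofReal
        gcongr
  have hfin := key Finset.univ
  have e2 : ∑ s, h s • unitVec n s = h := by
    ext i; rw [partial_apply]; simp
  rw [e2] at hfin
  refine hfin.trans (le_of_eq ?_)
  rw [Finset.card_univ, Fintype.card_fin, mul_assoc, ENNReal.ofReal_mul (p := (n : ℝ)) (Nat.cast_nonneg n), ENNReal.ofReal_natCast]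

lemma case_sobolev (hn : 2 ≤ n) {p q α s : ℝ} (hp : p = q / (q - 1)) (hq1 : 1 < q) (hq2 : q < 2)
    (hα0 : 0 < α) (hα : 1 + α ≤ q) {Ω : Set 𝔼} {Du Df : 𝔼 → 𝔼} {u f : 𝔼 → ℝ} 
    (hu : MemW1Loc n q Ω u Du) (hsol : IsLocalWeakSolution n q Ω Du f) (hf : MemW1Loc n p Ω f Df) {z : 𝔼} {r : ℝ} 
    (hr : 0 < r) (hr1 : r ≤ 1) (hB : closedBall z (20 * r) ⊆ Ω)
    (hs0 : 0 < s) (hs : s * ((n : ℝ) - 1 - α) < n * p) :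
    IntegrableOn (fun x => ‖Hmap n (q - 1) (Du x)‖ ^ s) (ball z r) volume := by
  have hp1 : 1 < p := by rw [hp, lt_div_iff₀ (by linarith)]; linarith
  have hB' : closedBall z (10 * r) ⊆ Ω := (closedBall_subset_closedBall (by linarith)).trans hB
  obtain ⟨h1, h2⟩ := hf.1 _ (isCompact_closedBall z (10 * r)) hB'
  obtain ⟨F, hFm, hFL, hF⟩ := exists_rep measurableSet_closedBall h1
  obtain ⟨G, hGm, hGL, hG⟩ := exists_rep measurableSet_closedBall h2
  refine local_reduction hn (A := (eLpNorm G (ENNReal.ofReal p) volume).toReal) hp hq1 hq2 hα0 hα hu hsol 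
    hr hr1 ENNReal.toReal_nonneg hB' hFL hF (fun h hh => ?_) hs0 hs
  refine (diff_sobolev (R := 10 * r) hp1.le hFm hGm hFL hGL (by linarith) 
    (weak_rep hf le_rfl hB' hF hG)).trans ?_
  rw [ENNReal.ofReal_mul ENNReal.toReal_nonneg, ENNReal.ofReal_toReal hGL.2.ne, mul_comm, ← ofReal_norm]
  gcongr
  rcases (norm_nonneg h).eq_or_lt with h0 | h0
  · rw [← h0]; positivity
  · have := Real.rpow_le_rpow_of_exponent_ge h0 (hh.trans hr1) (show α ≤ 1 by linarith)
    simpa using this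

lemma case_besov (hn : 2 ≤ n) {p q α β s : ℝ} (hp : p = q / (q - 1)) (hq1 : 1 < q) (hq2 : q < 2)
    (hα0 : 0 < α) (hα : 1 + α ≤ q) (hαβ : α ≤ β) {Ω : Set 𝔼} {Du : 𝔼 → 𝔼} {u f : 𝔼 → ℝ} 
    (hu : MemW1Loc n q Ω u Du) (hsol : IsLocalWeakSolution n q Ω Du f) (hf : MemBesovLoc n p β Ω f) {z : 𝔼} {r : ℝ} 
    (hr : 0 < r) (hr1 : r ≤ 1) (hB : closedBall z (20 * r) ⊆ Ω)
    (hs0 : 0 < s) (hs : s * ((n : ℝ) - 1 - α) < n * p) :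
    IntegrableOn (fun x => ‖Hmap n (q - 1) (Du x)‖ ^ s) (ball z r) volume := by
  have hp1 : 1 < p := by rw [hp, lt_div_iff₀ (by linarith)]; linarith
  have hp0 : 0 < p := by linarith
  have hB' : closedBall z (10 * r) ⊆ Ω := (closedBall_subset_closedBall (by linarith)).trans hB
  by_cases hm : AEStronglyMeasurable f (volume.restrict (closedBall z (10 * r)))
  · have hfL : MemLp f (ENNReal.ofReal p) (volume.restrict (closedBall z (10 * r))) := by
      rw [← integrable_norm_rpow_iff hm (by simpa using hp0) ENNReal.ofReal_ne_top, ENNReal.toReal_ofReal hp0.le]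
      have := (hf z (20 * r) (by linarith) hB).1
      exact this.mono_set (closedBall_subset_ball (by linarith))
    obtain ⟨F, hFm, hFL, hF⟩ := exists_rep measurableSet_closedBall hfL
    obtain ⟨A, hA0, hA⟩ := besov_diff hp1 hr hFL hF 
      (hf z (5 * r) (by linarith) ((closedBall_subset_closedBall (by linarith)).trans hB)).2
    refine local_reduction hn (A := n * A) hp hq1 hq2 hα0 hα hu hsol 
      hr hr1 (by positivity) hB' hFL hF (fun h hh => ?_) hs0 hs
    refine (telescope hp1 (hα0.trans_le hαβ) hA0 hFL hA h hh).trans ?_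
    apply ENNReal.ofReal_le_ofReal
    have hle : ‖h‖ ^ β ≤ ‖h‖ ^ α := by
      rcases (norm_nonneg h).eq_or_lt with h0 | h0
      · rw [← h0, Real.zero_rpow (by linarith)]; positivity
      · exact Real.rpow_le_rpow_of_exponent_ge h0 (hh.trans hr1) hαβ
    exact mul_le_mul_of_nonneg_left hle (by positivity)
  · have hsol0 := zero_sol hp hq1 hu hsol hr hB hm
    exact local_reduction hn (A := 0) (F := fun _ => 0) hp hq1 hq2 hα0 hα hu hsol0 
      hr hr1 le_rfl hB' MemLp.zero (Eventually.of_forall fun x => rfl) (fun h hh => by simp) hs0 hs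

end PartL

/-- **Corollary (higher integrability of the optimal traffic flow, `1 < q < 2`).**
Let `n ≥ 2`, `q ∈ (1,2)`, `p = q/(q−1)`, `α ∈ (0,1)`, `Ω ⊂ ℝⁿ` bounded open,
`u ∈ W^{1,q}_loc(Ω)` a local weak solution of `−div((|∇u|−1)_+^{q−1}∇u/|∇u|) = f`, and
`σ₀ = H_{q−1}(∇u)`.  Then:
(i) if `f ∈ W^{1,p}_loc(Ω)`, then `σ₀ ∈ L^r_loc(Ω)` for all `r ∈ [1, np(3−q)/(n(3−q)−2))`;
(ii) if `f ∈ B^α_{p,∞,loc}(Ω)`, then `σ₀ ∈ L^s_loc(Ω)` for all `s < np/(n−α−1)` when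
`0 < α < (q−1)/(3−q)`, and for all `s < np(3−q)/(n(3−q)−2)` when `(q−1)/(3−q) ≤ α < 1`. -/
theorem stmt4 (n : ℕ) (hn : 2 ≤ n) (q p α : ℝ) (hq1 : 1 < q) (hq2 : q < 2)
    (hp : p = q / (q - 1)) (hα1 : 0 < α) (hα2 : α < 1)
    (Ω : Set (EuclideanSpace ℝ (Fin n))) (hΩo : IsOpen Ω) (hΩb : Bornology.IsBounded Ω)
    (u f : EuclideanSpace ℝ (Fin n) → ℝ)
    (Du : EuclideanSpace ℝ (Fin n) → EuclideanSpace ℝ (Fin n))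
    (hu : MemW1Loc n q Ω u Du)
    (hsol : IsLocalWeakSolution n q Ω Du f)
    (σ₀ : EuclideanSpace ℝ (Fin n) → EuclideanSpace ℝ (Fin n))
    (hσ₀ : σ₀ = fun x => Hmap n (q - 1) (Du x)) :
    ((∃ Df : EuclideanSpace ℝ (Fin n) → EuclideanSpace ℝ (Fin n), MemW1Loc n p Ω f Df) →
      ∀ r : ℝ, 1 ≤ r → r < (n : ℝ) * p * (3 - q) / ((n : ℝ) * (3 - q) - 2) →
        ∀ K : Set (EuclideanSpace ℝ (Fin n)), IsCompact K → K ⊆ Ω →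
          IntegrableOn (fun x => ‖σ₀ x‖ ^ r) K volume) ∧
    (MemBesovLoc n p α Ω f →
      ∀ s : ℝ, 1 ≤ s →
        ((α < (q - 1) / (3 - q) ∧ s < (n : ℝ) * p / ((n : ℝ) - α - 1)) ∨
          ((q - 1) / (3 - q) ≤ α ∧ s < (n : ℝ) * p * (3 - q) / ((n : ℝ) * (3 - q) - 2))) →
        ∀ K : Set (EuclideanSpace ℝ (Fin n)), IsCompact K → K ⊆ Ω →
          IntegrableOn (fun x => ‖σ₀ x‖ ^ s) K volume) := by
  have h3 : 0 < 3 - q := by linarith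
  have hn' : (2 : ℝ) ≤ n := by exact_mod_cast hn
  have hα0 : 0 < (q - 1) / (3 - q) := div_pos (by linarith) h3
  have hαq : 1 + (q - 1) / (3 - q) ≤ q := by
    have : (q - 1) / (3 - q) ≤ q - 1 := div_le_self (by linarith) (by linarith)
    linarith
  have hden : 0 < (n : ℝ) * (3 - q) - 2 := by nlinarith
  have hconv : ∀ s : ℝ, s < (n : ℝ) * p * (3 - q) / ((n : ℝ) * (3 - q) - 2) → 
      s * ((n : ℝ) - 1 - (q - 1) / (3 - q)) < n * p := by
    intro s hs
    rw [lt_div_iff₀ hden] at hs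
    have e : s * ((n : ℝ) - 1 - (q - 1) / (3 - q)) = s * ((n : ℝ) * (3 - q) - 2) / (3 - q) := by
      field_simp; ring
    rw [e, div_lt_iff₀ h3]
    exact hs
  subst hσ₀
  refine ⟨?_, ?_⟩
  · rintro ⟨Df, hf⟩ r hr1 hr K hK hKΩ
    exact cover_integrable hΩo hK hKΩ fun z ρ hρ hρ1 hB => 
      case_sobolev hn hp hq1 hq2 hα0 hαq hu hsol hf hρ hρ1 hB (by linarith) (hconv r hr)
  · intro hf s hs1 hs K hK hKΩ
    refine cover_integrable hΩo hK hKΩ fun z ρ hρ hρ1 hB => ?_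
    rcases hs with ⟨hα, hs⟩ | ⟨hα, hs⟩
    · refine case_besov hn hp hq1 hq2 hα1 (by linarith) le_rfl hu hsol hf hρ hρ1 hB (by linarith) ?_
      rw [lt_div_iff₀ (by linarith)] at hs
      rwa [show (n : ℝ) - 1 - α = n - α - 1 by ring]
    · exact case_besov hn hp hq1 hq2 hα0 hαq hα hu hsol hf hρ hρ1 hB (by linarith) (hconv s hs)
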